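/- arXiv:0902.3093 — 3 statements merged into one kernel-verified Lean document; each statement's English description precedes it below -/
import Mathlib

section
/- Let A be an additive basis of order h, and let X be a finite nonempty subset of A, of cardinality k, such that A \ X is still an additive basis. Then G(A \ X) ≤ (h+1)·C(h+k−1, k) − k·C(h+k−1, k+1), where C(n, r) denotes the binomial coefficient. -/
open Pointwise

/-- The `h`-fold sumset of a set `S` of integers:
sums of `h` elements of `S` (with repetitions); `0`-fold sumset is `{0}`. -/
def foldSum (h : ℕ) (S : Set ℤ) : Set ℤ :=
  {z : ℤ | ∃ f : Fin h → ℤ, (∀ i, f i ∈ S) ∧ ∑ i, f i = z}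

/-- Every sufficiently large integer is a sum of `h` elements of `A`. -/
def RepBy (A : Set ℤ) (h : ℕ) : Prop :=
  ∀ᶠ N : ℤ in Filter.atTop, N ∈ foldSum h A

/-- `A ⊆ ℤ` is an additive basis: it has only finitely many negative elements and
there is `h ≥ 1` such that every sufficiently large positive integer is a
sum of `h` elements of `A`. -/
def IsAdditiveBasis (A : Set ℤ) : Prop :=
  {n : ℤ | n ∈ A ∧ n < 0}.Finite ∧ ∃ h : ℕ, 1 ≤ h ∧ RepBy A h

/-- The order `G(A)` of an additive basis: the least `h ≥ 1` such that every
sufficiently large positive integer is a sum of `h` elements of `A`. -/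
noncomputable def basisOrder (A : Set ℤ) : ℕ :=
  sInf {h : ℕ | 1 ≤ h ∧ RepBy A h}

/-- The diameter of a finite set of integers: `max {|x - y| : x, y ∈ X}` (as a natural number). -/
def diamN (X : Finset ℤ) : ℕ :=
  (X ×ˢ X).sup fun p => (p.1 - p.2).natAbs

/-- `δ(X) := gcd {x - y : x, y ∈ X}`, with the convention `δ(X) = 1` when `|X| = 1`. -/
def deltaN (X : Finset ℤ) : ℕ :=
  if 2 ≤ X.card then (X ×ˢ X).gcd (fun p => (p.1 - p.2).natAbs) else 1

namespace NashPf
open Classical in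
/-- number of elements of `S` in `[1,m]`. -/
noncomputable def cn (S : Set ℕ) (m : ℕ) : ℕ := ((Finset.Icc 1 m).filter (fun z => z ∈ S)).card

def SumN {ι : Type} [Fintype ι] (A : Set ℕ) (B : ι → Set ℕ) (n : ℕ) : Prop :=
  ∃ a ∈ A, ∃ b : ι → ℕ, (∀ j, b j ∈ B j) ∧ a + ∑ j, b j = n

lemma sumN_stab {ι : Type} [Fintype ι] [DecidableEq ι] (A : Set ℕ) (B : ι → Set ℕ) (n e y : ℕ)
    (hst : ∀ e' ∈ A, e' < e → ∀ j, ∀ b ∈ B j, e' + b ≤ n → e' + b ∈ A)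
    (hy : y < e) (hyn : y ≤ n) (h : SumN A B y) : y ∈ A := by
  obtain ⟨a, ha, b, hb, hs⟩ := h
  have key : ∀ s : Finset ι, a + ∑ j ∈ s, b j ∈ A := by
    intro s
    induction s using Finset.induction_on with
    | empty => simpa using ha
    | insert j s hj ih =>
      have h1 : ∑ i ∈ insert j s, b i ≤ ∑ i, b i :=
        Finset.sum_le_sum_of_subset (Finset.subset_univ _)
      rw [Finset.sum_insert hj] at h1 ⊢
      have := hst _ ih (by omega) j (b j) (hb j) (by omega)
      rwa [show a + (b j + ∑ i ∈ s, b i) = a + ∑ i ∈ s, b i + b j by ring]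
  have := key Finset.univ
  rwa [hs] at this

lemma cn_split (S : Set ℕ) (b m : ℕ) (hb : 1 ≤ b) (hbm : b ≤ m) (hS : ∀ z, b ≤ z → z ≤ m → z ∈ S) :
    cn S (b - 1) + (m - b + 1) ≤ cn S m := by
  classical
  unfold cn
  have : ((Finset.Icc 1 (b-1)).filter (fun z => z ∈ S)) ∪ Finset.Icc b m ⊆
      (Finset.Icc 1 m).filter (fun z => z ∈ S) := by
    intro z hz
    simp only [Finset.mem_union, Finset.mem_filter, Finset.mem_Icc] at hz ⊢
    rcases hz with hz | hz
    · exact ⟨by omega, hz.2⟩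
    · exact ⟨by omega, hS z hz.1 hz.2⟩
  have h2 := Finset.card_le_card this
  rw [Finset.card_union_of_disjoint] at h2
  · rw [Nat.card_Icc] at h2
    omega
  · rw [Finset.disjoint_left]
    intro z hz
    simp only [Finset.mem_filter, Finset.mem_Icc] at hz ⊢
    omega

lemma cn_mono_right (S : Set ℕ) {a b : ℕ} (h : a ≤ b) : cn S a ≤ cn S b := by
  classical
  unfold cn
  apply Finset.card_le_card
  apply Finset.filter_subset_filter
  exact Finset.Icc_subset_Icc_right h

/-- the transform does not lose, when nothing is lost in `(m-e,m]`. -/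
lemma cn_move (A B : Set ℕ) (n e m : ℕ) (hm : m ≤ n)
    (hlost : ∀ b ∈ B, b ≤ m → b + e ∉ A → b + e ≤ n → b + e ≤ m) (h0 : e ∈ A) :
    cn A m + cn B m ≤ cn (A ∪ {z | ∃ b ∈ B, z = b + e}) m + cn {b | b ∈ B ∧ (b + e ∈ A ∨ n < b + e)} m := by
  classical
  set F := (Finset.Icc 1 m).filter (fun b => b ∈ B ∧ ¬ (b + e ∈ A ∨ n < b + e)) with hF
  have h1 : cn B m = cn {b | b ∈ B ∧ (b + e ∈ A ∨ n < b + e)} m + F.card := by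
    unfold cn
    rw [← Finset.card_union_of_disjoint]
    · congr 1
      ext z
      simp only [hF, Finset.mem_union, Finset.mem_filter, Set.mem_ofPred_eq]
      tauto
    · rw [Finset.disjoint_left]
      intro z hz
      simp only [hF, Finset.mem_filter, Set.mem_ofPred_eq] at hz ⊢
      tauto
  have h2 : cn A m + F.card ≤ cn (A ∪ {z | ∃ b ∈ B, z = b + e}) m := by
    unfold cn
    rw [← Finset.card_image_of_injective F (add_left_injective e), ← Finset.card_union_of_disjoint]
    · apply Finset.card_le_card
      intro z hz
      simp only [hF, Finset.mem_union, Finset.mem_filter, Finset.mem_image, Finset.mem_Icc,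
        Set.mem_union, Set.mem_ofPred_eq] at hz ⊢
      rcases hz with hz | ⟨b, ⟨⟨hb1, hb2⟩, hb3, hb4⟩, rfl⟩
      · tauto
      · push Not at hb4
        have := hlost b hb3 hb2 hb4.1 hb4.2
        exact ⟨⟨by omega, this⟩, Or.inr ⟨b, hb3, rfl⟩⟩
    · rw [Finset.disjoint_left]
      intro z hz
      simp only [hF, Finset.mem_filter, Finset.mem_image, not_exists, not_and] at hz ⊢
      rintro b ⟨_, _, hb⟩ rfl
      tauto
  omega

theorem dyson {ι : Type} [Fintype ι] [DecidableEq ι] : ∀ n : ℕ, ∀ (A : Set ℕ) (B : ι → Set ℕ),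
    0 ∈ A → (∀ j, 0 ∈ B j) → (∀ m ≤ n, m ≤ cn A m + ∑ j, cn (B j) m) → SumN A B n := by
  classical
  intro n
  induction n using Nat.strong_induction_on with
  | _ n IH =>
  suffices H : ∀ s : ℕ, ∀ (A : Set ℕ) (B : ι → Set ℕ), ∑ j, cn (B j) n = s →
    0 ∈ A → (∀ j, 0 ∈ B j) → (∀ m ≤ n, m ≤ cn A m + ∑ j, cn (B j) m) → SumN A B n from
    fun A B => H _ A B rfl
  intro s
  induction s using Nat.strong_induction_on with
  | _ s IHs =>
  intro A B hs hA hB hc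
  have triv : n ∈ A → SumN A B n := fun h => ⟨n, h, fun _ => 0, hB, by simp⟩
  by_cases hex : ∃ e, e ∈ A ∧ ∃ j, ∃ b ∈ B j, e + b ≤ n ∧ e + b ∉ A
  · let e := Nat.find hex
    obtain ⟨heA, j, b1, hb1, hb1n, hb1A⟩ := Nat.find_spec hex
    have hmin : ∀ e' ∈ A, e' < e → ∀ j, ∀ b ∈ B j, e' + b ≤ n → e' + b ∈ A := by
      intro e' he' hlt j b hb hle
      by_contra hcon
      exact Nat.find_min hex hlt ⟨he', j, b, hb, hle, hcon⟩
    change e ∈ A at heA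
    change e + b1 ≤ n at hb1n
    change e + b1 ∉ A at hb1A
    have hfull : ∀ y, y < e → y ∈ A := by
      intro y hy
      exact sumN_stab A B n e y hmin hy (by omega)
        (IH y (by omega) A B hA hB (fun m hm => hc m (by omega)))
    set A' := A ∪ {z | ∃ b ∈ B j, z = b + e} with hA'
    set Bj := {b | b ∈ B j ∧ (b + e ∈ A ∨ n < b + e)} with hBj
    set B' := Function.update B j Bj with hB'
    have hsum : ∀ m, ∑ i, cn (B' i) m = cn Bj m + ∑ i ∈ Finset.univ.erase j, cn (B i) m := by
      intro m
      rw [← Finset.add_sum_erase _ _ (Finset.mem_univ j)]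
      congr 1
      · simp [hB']
      · apply Finset.sum_congr rfl
        intro i hi
        rw [hB', Function.update_of_ne (Finset.ne_of_mem_erase hi)]
    have hsum0 : ∀ m, ∑ i, cn (B i) m = cn (B j) m + ∑ i ∈ Finset.univ.erase j, cn (B i) m := by
      intro m
      rw [← Finset.add_sum_erase _ _ (Finset.mem_univ j)]
    have hb10 : b1 ≠ 0 := by
      rintro rfl
      exact hb1A (by simpa using heA)
    have hlt : cn Bj n < cn (B j) n := by
      unfold cn
      apply Finset.card_lt_card
      rw [Finset.ssubset_iff_of_subset]
      · refine ⟨b1, ?_, ?_⟩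
        · simp only [Finset.mem_filter, Finset.mem_Icc]
          exact ⟨by omega, hb1⟩
        · simp only [Finset.mem_filter, hBj, Set.mem_ofPred_eq, not_and]
          rintro - - (h | h)
          · exact hb1A (by rwa [add_comm])
          · omega
      · intro z
        simp only [Finset.mem_filter, hBj, Set.mem_ofPred_eq]
        tauto
    have hc' : ∀ m ≤ n, m ≤ cn A' m + ∑ i, cn (B' i) m := by
      intro m
      induction m using Nat.strong_induction_on with
      | _ m IHm =>
      intro hm
      by_cases hl : ∀ b ∈ B j, b ≤ m → b + e ∉ A → b + e ≤ n → b + e ≤ m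
      · have h1 : cn A m + cn (B j) m ≤ cn A' m + cn Bj m := cn_move A (B j) n e m hm hl heA
        have h2 := hc m hm
        rw [hsum0] at h2
        rw [hsum]
        omega
      · push Not at hl
        obtain ⟨b0, hb0, hb0m, hb0A, hb0n, hb0m'⟩ := hl
        have hb00 : b0 ≠ 0 := by
          rintro rfl
          exact hb0A (by simpa using heA)
        have h1 := IHm (b0 - 1) (by omega) (by omega)
        have h2 := cn_split A' b0 m (by omega) hb0m (by
          intro z hz1 hz2
          left
          have := hmin (z - b0) (hfull _ (by omega)) (by omega) j b0 hb0 (by omega)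
          rwa [Nat.sub_add_cancel hz1] at this)
        have h3 : ∑ i, cn (B' i) (b0 - 1) ≤ ∑ i, cn (B' i) m :=
          Finset.sum_le_sum (fun i _ => cn_mono_right _ (by omega))
        omega
    have hfin := IHs (∑ i, cn (B' i) n) (by rw [← hs, hsum, hsum0]; omega) A' B' rfl (Or.inl hA)
      (by
        intro i
        by_cases hij : i = j
        · subst hij
          simp only [hB', Function.update_self, hBj, Set.mem_ofPred_eq]
          exact ⟨hB i, Or.inl (by simpa using heA)⟩
        · rw [hB', Function.update_of_ne hij]; exact hB i) hc'
    obtain ⟨a, ha, b, hb, hab⟩ := hfin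
    have hbj : b j ∈ Bj := by simpa [hB'] using hb j
    have hbi : ∀ i, i ≠ j → b i ∈ B i := by
      intro i hi
      simpa [hB', Function.update_of_ne hi] using hb i
    have hbB : ∀ i, b i ∈ B i := by
      intro i
      by_cases hij : i = j
      · subst hij; exact hbj.1
      · exact hbi i hij
    rcases ha with ha | ⟨b2, hb2, rfl⟩
    · exact ⟨a, ha, b, hbB, hab⟩
    · have hle : b j ≤ ∑ i, b i := Finset.single_le_sum (fun _ _ => Nat.zero_le _) (Finset.mem_univ j)
      have hin : b j + e ∈ A := by
        rcases hbj.2 with h | h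
        · exact h
        · omega
      refine ⟨b j + e, hin, Function.update b j b2, ?_, ?_⟩
      · intro i
        by_cases hij : i = j
        · subst hij; simpa using hb2
        · rw [Function.update_of_ne hij]; exact hbi i hij
      · rw [← hab, Finset.sum_update_of_mem (Finset.mem_univ j),
          ← Finset.add_sum_erase _ b (Finset.mem_univ j), Finset.erase_eq]
        ring
  · push Not at hex
    by_cases hz : ∃ j, ∃ b ∈ B j, 1 ≤ b ∧ b ≤ n
    · obtain ⟨j, b, hb, hb1, hbn⟩ := hz
      have h1 : n - b ∈ A := sumN_stab A B n (n+1) (n-b)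
        (fun e' he' _ j b hb hle => hex e' he' j b hb hle) (by omega) (by omega)
        (IH (n-b) (by omega) A B hA hB (fun m hm => hc m (by omega)))
      have := hex _ h1 j b hb (by omega)
      rw [Nat.sub_add_cancel hbn] at this
      exact triv this
    · push Not at hz
      have h0 : ∑ j, cn (B j) n = 0 := by
        apply Finset.sum_eq_zero
        intro j _
        unfold cn
        rw [Finset.card_eq_zero, Finset.filter_eq_empty_iff]
        intro z hz1 hz2
        rw [Finset.mem_Icc] at hz1
        have := hz j z hz2 hz1.1
        omega
      have h1 := hc n le_rfl
      rw [h0, add_zero] at h1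
      by_cases hn : n = 0
      · subst hn; exact triv hA
      · apply triv
        unfold cn at h1
        have h2 : ((Finset.Icc 1 n).filter (fun z => z ∈ A)) = Finset.Icc 1 n := by
          apply Finset.eq_of_subset_of_card_le (Finset.filter_subset _ _)
          rw [Nat.card_Icc]; omega
        have h3 : n ∈ (Finset.Icc 1 n).filter (fun z => z ∈ A) := by
          rw [h2, Finset.mem_Icc]; omega
        exact (Finset.mem_filter.mp h3).2

end NashPf

namespace NashPf
open Classical in
/-- number of elements of `S` in `[0,m)`. -/
noncomputable def cnt (S : Set ℤ) (m : ℕ) : ℕ := ((Finset.Ico (0:ℤ) m).filter (fun z => z ∈ S)).card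

lemma cnt_mono {S T : Set ℤ} (h : S ⊆ T) (m : ℕ) : cnt S m ≤ cnt T m := by
  classical
  unfold cnt
  apply Finset.card_le_card
  intro z
  simp only [Finset.mem_filter]
  exact fun hz => ⟨hz.1, h hz.2⟩

lemma cnt_le (S : Set ℤ) (m : ℕ) : cnt S m ≤ m := by
  classical
  unfold cnt
  refine (Finset.card_filter_le _ _).trans ?_
  simp

lemma cnt_union {S T : Set ℤ} (h : Disjoint S T) (m : ℕ) : cnt (S ∪ T) m = cnt S m + cnt T m := by
  classical
  unfold cnt
  rw [← Finset.card_union_of_disjoint]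
  · congr 1
    ext z
    simp only [Finset.mem_union, Finset.mem_filter, Set.mem_union]
    tauto
  · rw [Finset.disjoint_left]
    intro z hz hz'
    simp only [Finset.mem_filter] at hz hz'
    exact Set.disjoint_left.mp h hz.2 hz'.2

lemma cnt_shift (S : Set ℤ) (e : ℤ) (m : ℕ) :
    cnt S m ≤ cnt {z | z - e ∈ S} m + e.natAbs := by
  classical
  unfold cnt
  set U := ((Finset.Ico (0:ℤ) m).filter (fun z => z ∈ S)) with hU
  have h1 : (U.image (fun z => z + e)) ⊆ ((Finset.Ico (0:ℤ) m).filter (fun z => z ∈ {z | z - e ∈ S}))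
      ∪ (if 0 ≤ e then Finset.Ico (m:ℤ) (m+e) else Finset.Ico e 0) := by
    intro z hz
    simp only [hU, Finset.mem_image, Finset.mem_filter, Finset.mem_Ico] at hz
    obtain ⟨y, ⟨⟨hy1, hy2⟩, hy3⟩, rfl⟩ := hz
    simp only [Finset.mem_union, Finset.mem_filter, Finset.mem_Ico, Set.mem_ofPred_eq, add_sub_cancel_right]
    by_cases hin : 0 ≤ y + e ∧ y + e < m
    · exact Or.inl ⟨hin, hy3⟩
    · right
      split_ifs with he
      · rw [Finset.mem_Ico]; omega
      · rw [Finset.mem_Ico]; omega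
  have h2 := Finset.card_le_card h1
  rw [Finset.card_image_of_injective _ (add_left_injective e)] at h2
  refine h2.trans ((Finset.card_union_le _ _).trans ?_)
  gcongr
  · split_ifs with he
    · rw [Int.card_Ico]; omega
    · rw [Int.card_Ico]; omega

structure IsMean (μ : Set ℤ → ℝ) : Prop where
  nonneg : ∀ S, 0 ≤ μ S
  le_one : ∀ S, μ S ≤ 1
  mono : ∀ S T, S ⊆ T → μ S ≤ μ T
  add : ∀ S T, Disjoint S T → μ (S ∪ T) = μ S + μ T
  shift : ∀ S e, μ {z | z - e ∈ S} = μ S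
  lower : ∀ (S : Set ℤ) (c C : ℝ), (∀ m : ℕ, c * m - C ≤ cnt S m) → c ≤ μ S

open Filter Topology in
theorem exists_mean : ∃ μ : Set ℤ → ℝ, IsMean μ := by
  let U : Ultrafilter ℕ := Filter.hyperfilter ℕ
  have hU : (U : Filter ℕ) ≤ atTop := Nat.hyperfilter_le_atTop
  have hr : ∀ S (n : ℕ), ((cnt S n : ℝ) / n) ∈ Set.Icc (0:ℝ) 1 := by
    intro S n
    refine ⟨by positivity, ?_⟩
    apply div_le_one_of_le₀ _ (by positivity)
    exact_mod_cast cnt_le S n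
  have hex : ∀ S, ∃ x ∈ Set.Icc (0:ℝ) 1, Tendsto (fun n : ℕ => (cnt S n : ℝ) / n) U (𝓝 x) := by
    intro S
    obtain ⟨x, hx, hle⟩ := (isCompact_Icc (a := (0:ℝ)) (b := 1)).ultrafilter_le_nhds
      (U.map (fun n : ℕ => (cnt S n : ℝ) / n)) (by
        rw [Filter.le_principal_iff]
        exact (Filter.univ_mem' (fun n => hr S n) : _ ∈ (U : Filter ℕ)))
    exact ⟨x, hx, hle⟩
  choose μ hμ hlim using hex
  have h0 : ∀ C : ℝ, Tendsto (fun n : ℕ => C / (n:ℝ)) U (𝓝 0) := fun C =>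
    (tendsto_const_div_atTop_nhds_zero_nat C).mono_left hU
  have hsh : ∀ S e, μ S ≤ μ {z | z - e ∈ S} := by
    intro S e
    have h1 := (hlim {z | z - e ∈ S}).add (h0 (e.natAbs : ℝ))
    rw [add_zero] at h1
    refine le_of_tendsto_of_tendsto' (hlim S) h1 ?_
    intro n
    rw [← add_div]
    gcongr
    exact_mod_cast cnt_shift S e n
  refine ⟨μ, fun S => (hμ S).1, fun S => (hμ S).2, ?_, ?_, ?_, ?_⟩
  · intro S T h
    refine le_of_tendsto_of_tendsto' (hlim S) (hlim T) ?_
    intro n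
    gcongr
    exact_mod_cast cnt_mono h n
  · intro S T h
    refine tendsto_nhds_unique (hlim (S ∪ T)) ?_
    refine ((hlim S).add (hlim T)).congr ?_
    intro n
    rw [cnt_union h, Nat.cast_add, add_div]
  · intro S e
    refine le_antisymm ?_ (hsh S e)
    have := hsh {z | z - e ∈ S} (-e)
    simpa using this
  · intro S c C hc
    have h1 := (hlim S).add (h0 C)
    rw [add_zero] at h1
    refine ge_of_tendsto h1 ?_
    filter_upwards [hU (eventually_gt_atTop 0)] with n hn
    have hn' : (0:ℝ) < n := by exact_mod_cast hn
    rw [← add_div, le_div_iff₀ hn']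
    have := hc n
    linarith

namespace IsMean
variable {μ : Set ℤ → ℝ}

lemma union_le (h : IsMean μ) (S T : Set ℤ) : μ (S ∪ T) ≤ μ S + μ T := by
  have h1 := h.add S (T \ S) Set.disjoint_sdiff_right
  rw [Set.union_sdiff_self] at h1
  rw [h1]
  have := h.mono (T \ S) T Set.sdiff_subset
  linarith

lemma empty (h : IsMean μ) : μ ∅ = 0 := by
  have h1 := h.add ∅ ∅ (Set.disjoint_empty _)
  rw [Set.union_self] at h1
  linarith

lemma biUnion_le {ι : Type} (h : IsMean μ) (s : Finset ι) (S : ι → Set ℤ) :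
    μ (⋃ i ∈ s, S i) ≤ ∑ i ∈ s, μ (S i) := by
  classical
  induction s using Finset.induction_on with
  | empty => simp [h.empty]
  | insert i s hi ih =>
    rw [Finset.set_biUnion_insert, Finset.sum_insert hi]
    have := h.union_le (S i) (⋃ i ∈ s, S i)
    linarith

lemma biUnion_eq {ι : Type} (h : IsMean μ) (s : Finset ι) (S : ι → Set ℤ)
    (hd : ∀ i ∈ s, ∀ j ∈ s, i ≠ j → Disjoint (S i) (S j)) :
    μ (⋃ i ∈ s, S i) = ∑ i ∈ s, μ (S i) := by
  classical
  induction s using Finset.induction_on with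
  | empty => simp [h.empty]
  | insert i s hi ih =>
    rw [Finset.set_biUnion_insert, Finset.sum_insert hi, h.add, ih]
    · intro a ha b hb
      exact hd a (Finset.mem_insert_of_mem ha) b (Finset.mem_insert_of_mem hb)
    · rw [Set.disjoint_iUnion₂_right]
      intro j hj
      exact hd i (Finset.mem_insert_self _ _) j (Finset.mem_insert_of_mem hj)
        (by rintro rfl; exact hi hj)

/-- a set of positive mean contains many pairs with a fixed small difference -/
lemma exists_gap (h : IsMean μ) (S : Set ℤ) (ρ ε : ℝ) (N : ℕ) (hN : 0 < N) (hS : ρ ≤ μ S)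
    (hρ : 1 / (N:ℝ) + N * ε < ρ) :
    ∃ p : ℕ, 1 ≤ p ∧ p ≤ N ∧ ε < μ {b | b ∈ S ∧ b + p ∈ S} := by
  classical
  by_contra hcon
  push Not at hcon
  set Z : Set ℤ := {b | b ∈ S ∧ ∀ p : ℕ, 1 ≤ p → p ≤ N → b + (p:ℤ) ∉ S} with hZ
  have hNr : (0:ℝ) < N := by exact_mod_cast hN
  have h1 : S ⊆ Z ∪ ⋃ p ∈ Finset.Icc 1 N, {b | b ∈ S ∧ b + ((p:ℕ):ℤ) ∈ S} := by
    intro b hb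
    by_cases hbZ : b ∈ Z
    · exact Or.inl hbZ
    · right
      simp only [hZ, Set.mem_ofPred_eq, not_and, not_forall, not_not] at hbZ
      obtain ⟨p, hp1, hp2, hp⟩ := hbZ hb
      simp only [Set.mem_iUnion]
      exact ⟨p, Finset.mem_Icc.mpr ⟨hp1, hp2⟩, hb, hp⟩
  have h2 : μ (⋃ p ∈ Finset.Icc 1 N, {b | b ∈ S ∧ b + ((p:ℕ):ℤ) ∈ S}) ≤ N * ε := by
    refine (h.biUnion_le _ _).trans ?_
    have := Finset.sum_le_card_nsmul (Finset.Icc 1 N) (fun p : ℕ => μ {b | b ∈ S ∧ b + ((p:ℕ):ℤ) ∈ S}) ε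
      (fun p hp => hcon p (Finset.mem_Icc.mp hp).1 (Finset.mem_Icc.mp hp).2)
    simpa using this
  have h3 : (N:ℝ) * μ Z ≤ 1 := by
    have h4 := h.biUnion_eq (Finset.range N) (fun q : ℕ => {z | z - (q:ℤ) ∈ Z}) (by
      have key : ∀ i j : ℕ, i < j → j < N → Disjoint {z : ℤ | z - (i:ℤ) ∈ Z} {z : ℤ | z - (j:ℤ) ∈ Z} := by
        intro i j hij hj
        rw [Set.disjoint_left]
        intro z hz1 hz2
        have := hz2.2 (j - i) (by omega) (by omega)
        apply this
        have h5 := hz1.1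
        rwa [show z - (j:ℤ) + ((j - i : ℕ):ℤ) = z - i by omega]
      intro i hi j hj hne
      rw [Finset.mem_range] at hi hj
      rcases lt_or_gt_of_ne hne with hlt | hlt
      · exact key i j hlt hj
      · exact (key j i hlt hi).symm)
    simp only [h.shift] at h4
    rw [Finset.sum_const, Finset.card_range, nsmul_eq_mul] at h4
    rw [← h4]
    exact h.le_one _
  have h5 : μ Z ≤ 1 / N := by
    rw [le_div_iff₀ hNr]; linarith
  have h6 := h.mono _ _ h1
  have h7 := h.union_le Z (⋃ p ∈ Finset.Icc 1 N, {b | b ∈ S ∧ b + ((p:ℕ):ℤ) ∈ S})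
  linarith

end IsMean
end NashPf

namespace NashPf
section
variable {ι : Type} [Fintype ι] [DecidableEq ι]

def InSum (A : Set ℤ) (B : ι → Set ℤ) (n : ℤ) : Prop :=
  ∃ a ∈ A, ∃ b : ι → ℤ, (∀ j, b j ∈ B j) ∧ a + ∑ j, b j = n

structure Desc (A : Set ℤ) (B : ι → Set ℤ) (A' : Set ℤ) (B' : ι → Set ℤ) : Prop where
  subA : A ⊆ A'
  subB : ∀ j, B' j ⊆ B j
  sum : ∀ n, InSum A' B' n → InSum A B n

lemma Desc.refl (A : Set ℤ) (B : ι → Set ℤ) : Desc A B A B :=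
  ⟨subset_rfl, fun _ => subset_rfl, fun _ h => h⟩

lemma Desc.trans {A A' A'' : Set ℤ} {B B' B'' : ι → Set ℤ} (h : Desc A B A' B')
    (h' : Desc A' B' A'' B'') : Desc A B A'' B'' :=
  ⟨h.subA.trans h'.subA, fun j => (h'.subB j).trans (h.subB j), fun n hn => h.sum n (h'.sum n hn)⟩

def Cond (η : ℝ) (A : Set ℤ) (B : ι → Set ℤ) : Prop :=
  ∃ K : ℝ, ∀ m : ℕ, (1 + η) * m - K ≤ cnt A m + ∑ j, (cnt (B j) m : ℝ)

def mvA (A S : Set ℤ) (e : ℤ) : Set ℤ := A ∪ {z | z - e ∈ S}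
def mvB (A S : Set ℤ) (e : ℤ) : Set ℤ := {b | b ∈ S ∧ b + e ∈ A}
def lost (A S : Set ℤ) (e : ℤ) : Set ℤ := {b | b ∈ S ∧ b + e ∉ A}

lemma sum_update_split (f : Set ℤ → ℝ) (B : ι → Set ℤ) (j : ι) (S : Set ℤ) :
    ∑ i, f (Function.update B j S i) = ∑ i, f (B i) - f (B j) + f S := by
  rw [← Finset.add_sum_erase _ _ (Finset.mem_univ j),
    ← Finset.add_sum_erase (a := j) _ (fun i => f (B i)) (Finset.mem_univ j)]
  have : ∑ i ∈ Finset.univ.erase j, f (Function.update B j S i) = ∑ i ∈ Finset.univ.erase j, f (B i) := by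
    apply Finset.sum_congr rfl
    intro i hi
    rw [Function.update_of_ne (Finset.ne_of_mem_erase hi)]
  rw [this]
  simp
  ring

lemma mvB_lost (A S : Set ℤ) (e : ℤ) : mvB A S e ∪ lost A S e = S := by
  ext z
  simp only [mvB, lost, Set.mem_union, Set.mem_ofPred_eq]
  tauto

lemma disj_mvB_lost (A S : Set ℤ) (e : ℤ) : Disjoint (mvB A S e) (lost A S e) := by
  rw [Set.disjoint_left]
  intro z h1 h2
  exact h2.2 h1.2

lemma mvA_eq (A S : Set ℤ) (e : ℤ) : mvA A S e = A ∪ {z | z - e ∈ lost A S e} := by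
  ext z
  simp only [mvA, lost, Set.mem_union, Set.mem_ofPred_eq, sub_add_cancel]
  tauto

lemma disj_mvA (A S : Set ℤ) (e : ℤ) : Disjoint A {z | z - e ∈ lost A S e} := by
  rw [Set.disjoint_left]
  intro z h1 h2
  have := h2.2
  rw [sub_add_cancel] at this
  exact this h1

lemma move_desc (A : Set ℤ) (B : ι → Set ℤ) (j : ι) (e : ℤ) :
    Desc A B (mvA A (B j) e) (Function.update B j (mvB A (B j) e)) := by
  have hsub : ∀ i, Function.update B j (mvB A (B j) e) i ⊆ B i := by
    intro i
    by_cases hij : i = j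
    · subst hij; rw [Function.update_self]; exact fun z hz => hz.1
    · rw [Function.update_of_ne hij]
  refine ⟨Set.subset_union_left, hsub, ?_⟩
  rintro n ⟨a, ha, b, hb, hab⟩
  rcases ha with ha | ha
  · exact ⟨a, ha, b, fun i => hsub i (hb i), hab⟩
  · have hj := hb j
    rw [Function.update_self] at hj
    refine ⟨b j + e, hj.2, Function.update b j (a - e), ?_, ?_⟩
    · intro i
      by_cases hij : i = j
      · subst hij; rw [Function.update_self]; exact ha
      · rw [Function.update_of_ne hij]; exact hsub i (hb i)
    · rw [← hab, Finset.sum_update_of_mem (Finset.mem_univ j),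
          ← Finset.add_sum_erase _ b (Finset.mem_univ j), Finset.erase_eq]
      ring

lemma move_cond {η : ℝ} {A : Set ℤ} {B : ι → Set ℤ} (j : ι) (e : ℤ) (h : Cond η A B) :
    Cond η (mvA A (B j) e) (Function.update B j (mvB A (B j) e)) := by
  obtain ⟨K, hK⟩ := h
  refine ⟨K + e.natAbs, fun m => ?_⟩
  rw [sum_update_split (fun S => (cnt S m : ℝ))]
  have h1 : (cnt (B j) m : ℝ) = cnt (mvB A (B j) e) m + cnt (lost A (B j) e) m := by
    rw [← Nat.cast_add, ← cnt_union (disj_mvB_lost _ _ _), mvB_lost]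
  have h2 : (cnt (mvA A (B j) e) m : ℝ) = cnt A m + cnt {z | z - e ∈ lost A (B j) e} m := by
    rw [← Nat.cast_add, ← cnt_union (disj_mvA _ _ _), mvA_eq]
  have h3 : (cnt (lost A (B j) e) m : ℝ) ≤ cnt {z | z - e ∈ lost A (B j) e} m + e.natAbs := by
    exact_mod_cast cnt_shift _ _ _
  have := hK m
  rw [h2, h1]
  linarith

/-- states reachable -/
structure Reach (η : ℝ) (A : Set ℤ) (B : ι → Set ℤ) (A' : Set ℤ) (B' : ι → Set ℤ) : Prop where
  desc : Desc A B A' B'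
  ne : ∀ j, (B' j).Nonempty
  cond : Cond η A' B'

lemma reach_move {η : ℝ} {A : Set ℤ} {B : ι → Set ℤ} {A' : Set ℤ} {B' : ι → Set ℤ}
    (h : Reach η A B A' B') (j : ι) (e : ℤ) (hne : (mvB A' (B' j) e).Nonempty) :
    Reach η A B (mvA A' (B' j) e) (Function.update B' j (mvB A' (B' j) e)) := by
  refine ⟨h.desc.trans (move_desc _ _ _ _), ?_, move_cond _ _ h.cond⟩
  intro i
  by_cases hij : i = j
  · subst hij; rwa [Function.update_self]
  · rw [Function.update_of_ne hij]; exact h.ne i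

structure Near (μ : Set ℤ → ℝ) (ε η : ℝ) (A : Set ℤ) (B : ι → Set ℤ) (A' : Set ℤ)
    (B' : ι → Set ℤ) : Prop where
  reach : Reach η A B A' B'
  near : ∀ A'' B'', Reach η A B A'' B'' → μ A'' ≤ μ A' + ε

lemma near_sup {α : Type} (P : α → Prop) (f : α → ℝ) (hf : ∀ x, f x ≤ 1) (x0 : α) (h0 : P x0) (ε : ℝ)
    (hε : 0 < ε) : ∃ x, P x ∧ ∀ y, P y → f y ≤ f x + ε := by
  have hb : BddAbove (f '' {x | P x}) := ⟨1, by rintro _ ⟨x, _, rfl⟩; exact hf x⟩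
  obtain ⟨_, ⟨x, hx, rfl⟩, hlt⟩ := exists_lt_of_lt_csSup (s := f '' {x | P x}) ⟨_, x0, h0, rfl⟩
    (sub_lt_self (sSup (f '' {x | P x})) hε)
  refine ⟨x, hx, fun y hy => ?_⟩
  have := le_csSup hb ⟨y, hy, rfl⟩
  linarith

lemma exists_near {μ : Set ℤ → ℝ} (hμ : IsMean μ) {ε η : ℝ} (hε : 0 < ε) {A : Set ℤ} {B : ι → Set ℤ}
    (hne : ∀ j, (B j).Nonempty) (hc : Cond η A B) : ∃ A' B', Near μ ε η A B A' B' := by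
  obtain ⟨⟨A', B'⟩, h1, h2⟩ := near_sup (fun p : Set ℤ × (ι → Set ℤ) => Reach η A B p.1 p.2)
    (fun p => μ p.1) (fun p => hμ.le_one _) (A, B) ⟨Desc.refl _ _, hne, hc⟩ ε hε
  exact ⟨A', B', h1, fun A'' B'' h => h2 (A'', B'') h⟩

lemma near_move {μ : Set ℤ → ℝ} (hμ : IsMean μ) {ε η : ℝ} {A : Set ℤ} {B : ι → Set ℤ} {A' : Set ℤ}
    {B' : ι → Set ℤ}
    (h : Near μ ε η A B A' B') (j : ι) (e : ℤ) (hne : (mvB A' (B' j) e).Nonempty) :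
    Near μ ε η A B (mvA A' (B' j) e) (Function.update B' j (mvB A' (B' j) e)) ∧
    μ (lost A' (B' j) e) ≤ ε := by
  have hr := reach_move h.reach j e hne
  have h2 : μ (mvA A' (B' j) e) = μ A' + μ (lost A' (B' j) e) := by
    rw [mvA_eq, hμ.add _ _ (disj_mvA _ _ _), hμ.shift]
  have h3 := h.near _ _ hr
  have h4 := hμ.nonneg (lost A' (B' j) e)
  refine ⟨⟨hr, fun A'' B'' h'' => ?_⟩, by linarith⟩
  have := h.near _ _ h''
  linarith

lemma all_moves {μ : Set ℤ → ℝ} (hμ : IsMean μ) {ε η ρ : ℝ} {A : Set ℤ} {B : ι → Set ℤ} {A' : Set ℤ}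
    {B' : ι → Set ℤ} (h : Near μ ε η A B A' B') (N : ℕ) (hN : 0 < N)
    (hρ : 1 / (N:ℝ) + N * ε < ρ)
    (hres : ∀ p : ℕ, 1 ≤ p → p ≤ N → ∀ r : ℤ, ∃ a ∈ A, (p:ℤ) ∣ r - a)
    (j : ι) (hj : ρ ≤ μ (B' j)) (e : ℤ) : (mvB A' (B' j) e).Nonempty := by
  obtain ⟨p, hp1, hpN, hp⟩ := hμ.exists_gap (B' j) ρ ε N hN hj hρ
  set T : Set ℤ := {b | b ∈ B' j ∧ b + (p:ℤ) ∈ B' j} with hT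
  have hlost : ∀ e : ℤ, (mvB A' (B' j) e).Nonempty → μ (lost A' (B' j) e) ≤ ε :=
    fun e he => (near_move hμ h j e he).2
  have hsub : ∀ e : ℤ, (mvB A' (B' j) e).Nonempty → (mvB A' (B' j) (e - p)).Nonempty := by
    intro e he
    by_contra hcon
    have h1 : T ⊆ lost A' (B' j) e := by
      intro b hb
      refine ⟨hb.1, fun hbA => hcon ⟨b + p, hb.2, ?_⟩⟩
      rwa [show b + p + (e - p) = b + e by ring]
    have := hμ.mono _ _ h1
    linarith [hlost e he]
  have hadd : ∀ e : ℤ, (mvB A' (B' j) e).Nonempty → (mvB A' (B' j) (e + p)).Nonempty := by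
    intro e he
    by_contra hcon
    have h1 : {z | z - (p:ℤ) ∈ T} ⊆ lost A' (B' j) e := by
      intro b hb
      have hb2 := hb.2
      rw [sub_add_cancel] at hb2
      refine ⟨hb2, fun hbA => hcon ⟨b - p, hb.1, ?_⟩⟩
      rwa [show b - p + (e + p) = b + e by ring]
    have := hμ.mono _ _ h1
    rw [hμ.shift] at this
    linarith [hlost e he]
  have hall : ∀ e : ℤ, (mvB A' (B' j) e).Nonempty → ∀ t : ℤ, (mvB A' (B' j) (e + t * p)).Nonempty := by
    intro e he t
    induction t using Int.induction_on with
    | zero => simpa using he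
    | succ i ih =>
      have := hadd _ ih
      rwa [show e + (i:ℤ) * p + p = e + ((i:ℤ) + 1) * p by ring] at this
    | pred i ih =>
      have := hsub _ ih
      rwa [show e + -(i:ℤ) * p - p = e + (-(i:ℤ) - 1) * p by ring] at this
  obtain ⟨b0, hb0⟩ := h.reach.ne j
  obtain ⟨a, ha, t, ht⟩ := hres p hp1 hpN (e + b0)
  have h1 : (mvB A' (B' j) (a - b0)).Nonempty := ⟨b0, hb0, by
    rw [add_sub_cancel]; exact h.reach.desc.subA ha⟩
  have := hall _ h1 t
  rwa [show a - b0 + t * p = e by linarith] at this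

lemma saturate {μ : Set ℤ → ℝ} (hμ : IsMean μ) {ε η ρ : ℝ} (hε : 0 < ε) {A : Set ℤ} {B : ι → Set ℤ}
    (hne : ∀ j, (B j).Nonempty) (hc : Cond η A B) (N : ℕ) (hN : 0 < N)
    (hρ : 1 / (N:ℝ) + N * ε < ρ)
    (hres : ∀ p : ℕ, 1 ≤ p → p ≤ N → ∀ r : ℤ, ∃ a ∈ A, (p:ℤ) ∣ r - a) (l : Finset (ι × ℤ)) :
    ∃ A' B', Near μ ε η A B A' B' ∧ ∀ q ∈ l, μ (B' q.1) < ρ ∨ ∀ b ∈ B' q.1, b + q.2 ∈ A' := by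
  induction l using Finset.induction_on with
  | empty =>
    obtain ⟨A', B', h⟩ := exists_near hμ hε hne hc
    exact ⟨A', B', h, by simp⟩
  | insert q l hq ih =>
    obtain ⟨A', B', h, hl⟩ := ih
    by_cases hthin : μ (B' q.1) < ρ
    · refine ⟨A', B', h, ?_⟩
      intro q' hq'
      rcases Finset.mem_insert.mp hq' with rfl | hq'
      · exact Or.inl hthin
      · exact hl q' hq'
    · push Not at hthin
      have hmv := all_moves hμ h N hN hρ hres q.1 hthin q.2
      have hd := move_desc A' B' q.1 q.2
      refine ⟨_, _, (near_move hμ h q.1 q.2 hmv).1, ?_⟩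
      intro q' hq'
      rcases Finset.mem_insert.mp hq' with rfl | hq'
      · right
        intro b hb
        rw [Function.update_self] at hb
        exact Or.inl hb.2
      · rcases hl q' hq' with h1 | h1
        · exact Or.inl ((hμ.mono _ _ (hd.subB q'.1)).trans_lt h1)
        · exact Or.inr (fun b hb => hd.subA (h1 b (hd.subB q'.1 hb)))

lemma cnt_succ (S : Set ℤ) [DecidablePred (· ∈ S)] (m : ℕ) :
    cnt S (m + 1) = cnt S m + if (m:ℤ) ∈ S then 1 else 0 := by
  classical
  unfold cnt
  have : Finset.Ico (0:ℤ) ((m+1 : ℕ):ℤ) = insert (m:ℤ) (Finset.Ico (0:ℤ) m) := by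
    ext z
    simp only [Finset.mem_Ico, Finset.mem_insert]
    omega
  rw [this, Finset.filter_insert]
  split_ifs with h
  · rw [Finset.card_insert_of_notMem (by simp)]
  · rfl

lemma cnt_zero (S : Set ℤ) : cnt S 0 = 0 := by
  simp [cnt]

lemma cnt_seg (S : Set ℤ) (x m : ℕ) (b : ℤ) (hb1 : ∀ z ∈ S, (x:ℤ) ≤ z → (x:ℤ) ≤ b ∧ b ≤ z) :
    cnt S (x + m + 1) ≤ cnt S x + cn {n : ℕ | b + (n:ℤ) ∈ S} m + 1 := by
  classical
  unfold cnt cn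
  have : (Finset.Ico (0:ℤ) ((x + m + 1 : ℕ):ℤ)).filter (fun z => z ∈ S) ⊆
      (Finset.Ico (0:ℤ) (x:ℤ)).filter (fun z => z ∈ S) ∪
      insert b (((Finset.Icc 1 m).filter (fun n => n ∈ {n : ℕ | b + (n:ℤ) ∈ S})).image
        (fun n : ℕ => b + (n:ℤ))) := by
    intro z hz
    simp only [Finset.mem_filter, Finset.mem_Ico, Finset.mem_union, Finset.mem_insert,
      Finset.mem_image, Finset.mem_Icc, Set.mem_ofPred_eq] at hz ⊢
    by_cases hzx : z < x
    · exact Or.inl ⟨⟨hz.1.1, hzx⟩, hz.2⟩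
    · right
      have h1 := hb1 z hz.2 (by omega)
      by_cases hzb : z = b
      · exact Or.inl hzb
      · right
        refine ⟨(z - b).toNat, ⟨by omega, ?_⟩, by omega⟩
        rw [show b + ((z - b).toNat : ℤ) = z by omega]
        exact hz.2
  refine (Finset.card_le_card this).trans ((Finset.card_union_le _ _).trans ?_)
  have h1 := Finset.card_insert_le b (((Finset.Icc 1 m).filter (fun n => n ∈ {n : ℕ | b + (n:ℤ) ∈ S})).image
        (fun n : ℕ => b + (n:ℤ)))
  have h2 := Finset.card_image_le (s := (Finset.Icc 1 m).filter (fun n => n ∈ {n : ℕ | b + (n:ℤ) ∈ S}))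
    (f := fun n : ℕ => b + (n:ℤ))
  have h3 := h1.trans (Nat.add_le_add_right h2 1)
  rw [add_assoc]
  refine Nat.add_le_add_left ?_ _
  convert h3 using 3

lemma exists_base (S : Set ℤ) (hS : S.Nonempty) (x : ℕ) :
    ∃ b ∈ S, ∀ z ∈ S, (x:ℤ) ≤ z → (x:ℤ) ≤ b ∧ b ≤ z := by
  by_cases h : ∃ z, z ∈ S ∧ (x:ℤ) ≤ z
  · obtain ⟨b, hb, hmin⟩ := Int.exists_least_of_bdd (P := fun z => z ∈ S ∧ (x:ℤ) ≤ z)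
      ⟨x, fun z hz => hz.2⟩ h
    exact ⟨b, hb.1, fun z hz hxz => ⟨hb.2, hmin z ⟨hz, hxz⟩⟩⟩
  · push Not at h
    obtain ⟨b, hb⟩ := hS
    exact ⟨b, hb, fun z hz hxz => absurd hxz (not_le.mpr (h z hz))⟩

end
end NashPf

namespace NashPf
section
variable {ι : Type} [Fintype ι] [DecidableEq ι]

/-- total counting function -/
noncomputable def tot (A : Set ℤ) (B : ι → Set ℤ) (m : ℕ) : ℝ := cnt A m + ∑ j, (cnt (B j) m : ℝ)

lemma cnt_succ_le (S : Set ℤ) (m : ℕ) : cnt S (m + 1) ≤ cnt S m + 1 := by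
  classical
  rw [cnt_succ]
  split_ifs <;> omega

lemma cnt_succ_notMem (S : Set ℤ) (m : ℕ) (h : (m:ℤ) ∉ S) : cnt S (m + 1) = cnt S m := by
  classical
  rw [cnt_succ, if_neg h]
  rfl

lemma cnt_succ_mem (S : Set ℤ) (m : ℕ) (h : (m:ℤ) ∈ S) : cnt S (m + 1) = cnt S m + 1 := by
  classical
  rw [cnt_succ, if_pos h]

lemma tot_succ_le (A : Set ℤ) (B : ι → Set ℤ) (m : ℕ) :
    tot A B (m + 1) ≤ tot A B m + (Fintype.card ι + 1) := by
  unfold tot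
  have h1 : (cnt A (m+1) : ℝ) ≤ cnt A m + 1 := by exact_mod_cast cnt_succ_le A m
  have h2 : ∑ j, (cnt (B j) (m+1) : ℝ) ≤ ∑ j, ((cnt (B j) m : ℝ) + 1) := by
    apply Finset.sum_le_sum
    intro j _
    exact_mod_cast cnt_succ_le (B j) m
  rw [Finset.sum_add_distrib] at h2
  simp at h2
  linarith

lemma tot_le (A : Set ℤ) (B : ι → Set ℤ) (m : ℕ) :
    tot A B m ≤ (Fintype.card ι + 1) * m := by
  induction m with
  | zero => simp [tot, cnt_zero]
  | succ m ih =>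
    have := tot_succ_le A B m
    push_cast
    linarith

/-- records -/
def records (F : ℕ → ℝ) : Set ℤ := {z | ∃ x : ℕ, z = x ∧ ∀ y, x < y → F x < F y}

lemma records_cnt (F : ℕ → ℝ) (k c K : ℝ) (h0 : F 0 ≤ 0) (hk : 0 ≤ k)
    (hstep : ∀ m, F (m+1) ≤ F m + k) (hc : 0 ≤ c) (hlow : ∀ m : ℕ, c * m - K ≤ F m) (m : ℕ) :
    c * m - K ≤ k * cnt (records F) m := by
  have hb : ∀ y, BddBelow (Set.range (fun n => F (y + n))) := by
    intro y
    refine ⟨-K, ?_⟩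
    rintro _ ⟨n, rfl⟩
    have := hlow (y + n)
    have h2 : 0 ≤ c * ((y + n : ℕ) : ℝ) := by positivity
    simp only
    linarith
  set M : ℕ → ℝ := fun y => ⨅ n, F (y + n) with hM
  have hMle : ∀ y n, M y ≤ F (y + n) := fun y n => ciInf_le (hb y) n
  have hind : ∀ m, M m ≤ k * cnt (records F) m := by
    intro m
    induction m with
    | zero =>
      rw [cnt_zero]
      have := hMle 0 0
      simp only [add_zero] at this
      simp
      linarith
    | succ m ih =>
      by_cases hr : (m:ℤ) ∈ records F
      · rw [cnt_succ_mem _ _ hr]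
        obtain ⟨x, hx, hx2⟩ := hr
        have hxm : x = m := by exact_mod_cast hx.symm
        subst hxm
        have h1 : F x ≤ M x := by
          apply le_ciInf
          intro n
          rcases Nat.eq_zero_or_pos n with rfl | hn
          · simp
          · exact (hx2 _ (by omega)).le
        have h2 := hMle (x+1) 0
        have h3 := hstep x
        simp only [add_zero] at h2
        push_cast
        linarith
      · rw [cnt_succ_notMem _ _ hr]
        refine le_trans ?_ ih
        apply le_ciInf
        intro n
        rcases Nat.eq_zero_or_pos n with rfl | hn
        · have : ∃ y, m < y ∧ F y ≤ F m := by
            by_contra hcon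
            push Not at hcon
            exact hr ⟨m, rfl, hcon⟩
          obtain ⟨y, hy, hle⟩ := this
          have := hMle (m+1) (y - (m+1))
          rw [show m + 1 + (y - (m+1)) = y by omega] at this
          simpa using this.trans hle
        · have := hMle (m+1) (n-1)
          rwa [show m + 1 + (n-1) = m + n by omega] at this
  refine le_trans ?_ (hind m)
  apply le_ciInf
  intro n
  refine le_trans ?_ (hlow (m + n))
  push_cast
  have : 0 ≤ c * (n:ℝ) := by positivity
  linarith

/-- final step: a record point followed by a full interval of `A` -/
lemma finish (A : Set ℤ) (B : ι → Set ℤ) (hne : ∀ j, (B j).Nonempty) (δ : ℝ) (hδ : 0 ≤ δ) (x R : ℕ)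
    (hR : Fintype.card ι + 1 ≤ δ * R) (hA : ∀ e : ℕ, e ≤ R → (x:ℤ) + e ∈ A)
    (hrec : ∀ y, x < y → tot A B x - (1 + δ) * x < tot A B y - (1 + δ) * y) :
    ∃ n0 : ℤ, ∀ n ≥ n0, InSum A B n := by
  classical
  choose b hb hbx using fun j => exists_base (B j) (hne j) x
  have hxA : (x:ℤ) ∈ A := by simpa using hA 0 (by omega)
  refine ⟨x + ∑ j, b j, fun n hn => ?_⟩
  obtain ⟨t, rfl⟩ : ∃ t : ℕ, n = x + ∑ j, b j + t := ⟨(n - (x + ∑ j, b j)).toNat, by omega⟩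
  have hD := dyson t {n : ℕ | (x:ℤ) + n ∈ A} (fun j => {n : ℕ | b j + (n:ℤ) ∈ B j})
    (by simpa using hxA) (by intro j; simpa using hb j) (by
      intro m _
      by_cases hmR : m ≤ R
      · have : m ≤ cn {n : ℕ | (x:ℤ) + n ∈ A} m := by
          unfold cn
          rw [Finset.filter_true_of_mem]
          · simp
          · intro z hz
            rw [Finset.mem_Icc] at hz
            exact hA z (by omega)
        omega
      · have h1 := hrec (x + m + 1) (by omega)
        have h2 : (cnt A (x + m + 1) : ℝ) ≤ cnt A x + cn {n : ℕ | (x:ℤ) + n ∈ A} m + 1 := by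
          exact_mod_cast cnt_seg A x m x (fun z _ hz => ⟨le_rfl, hz⟩)
        have h3 : ∑ j, (cnt (B j) (x + m + 1) : ℝ) ≤
            ∑ j, ((cnt (B j) x : ℝ) + (cn {n : ℕ | b j + (n:ℤ) ∈ B j} m + 1)) := by
          apply Finset.sum_le_sum
          intro j _
          have := cnt_seg (B j) x m (b j) (hbx j)
          rw [← add_assoc]
          exact_mod_cast this
        rw [Finset.sum_add_distrib, Finset.sum_add_distrib] at h3
        simp only [Finset.sum_const, Finset.card_univ, nsmul_eq_mul, mul_one] at h3
        unfold tot at h1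
        push_cast at h1
        have h5 : δ * R ≤ δ * m := by
          apply mul_le_mul_of_nonneg_left _ hδ
          push Not at hmR
          exact_mod_cast hmR.le
        have h4 : (m:ℝ) ≤ cn {n : ℕ | (x:ℤ) + n ∈ A} m + ∑ j, (cn {n : ℕ | b j + (n:ℤ) ∈ B j} m : ℝ) := by
          nlinarith
        exact_mod_cast h4)
  obtain ⟨a, ha, c, hc, hs⟩ := hD
  refine ⟨x + a, ha, fun j => b j + c j, hc, ?_⟩
  rw [Finset.sum_add_distrib, ← hs]
  push_cast
  ring

theorem thmD (A : Set ℤ) (B : ι → Set ℤ) (hne : ∀ j, (B j).Nonempty) (η : ℝ) (hη : 0 < η)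
    (hc : Cond η A B)
    (hres : ∀ p : ℕ, 1 ≤ p → p * η ≤ 5 * (Fintype.card ι + 1) ^ 2 → ∀ r : ℤ, ∃ a ∈ A, (p:ℤ) ∣ r - a) :
    ∃ n0 : ℤ, ∀ n ≥ n0, InSum A B n := by
  classical
  obtain ⟨μ, hμ⟩ := exists_mean
  set k : ℝ := Fintype.card ι + 1 with hk
  have hk1 : 1 ≤ k := by
    rw [hk]; have : (0:ℝ) ≤ Fintype.card ι := by positivity
    linarith
  have hηk : η ≤ k := by
    obtain ⟨K, hK⟩ := hc
    by_contra hcon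
    push Not at hcon
    obtain ⟨m, hm⟩ := exists_nat_gt K
    have h1 := hK m
    have h2 := tot_le A B m
    unfold tot at h2
    have h3 : (0:ℝ) ≤ m := by positivity
    have h4 := h1.trans h2
    rw [← hk] at h4
    nlinarith
  set ρ : ℝ := η / (2 * k ^ 2) with hρ
  have hρ0 : 0 < ρ := by positivity
  set N : ℕ := ⌈2 / ρ⌉₊ with hN
  have hN1 : 2 / ρ ≤ N := Nat.le_ceil _
  have hN2 : (N:ℝ) < 2 / ρ + 1 := Nat.ceil_lt_add_one (by positivity)
  have hN0 : (0:ℝ) < N := lt_of_lt_of_le (by positivity) hN1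
  have hN0' : 0 < N := by exact_mod_cast hN0
  set ε : ℝ := ρ / (4 * N) with hε
  have hε0 : 0 < ε := by positivity
  have hNρ : 1 / (N:ℝ) + N * ε < ρ := by
    have h1 : 1 / (N:ℝ) ≤ ρ / 2 := by
      rw [div_le_div_iff₀ hN0 (by norm_num)]
      rw [div_le_iff₀ hρ0] at hN1
      linarith
    have h2 : N * ε = ρ / 4 := by
      rw [hε]; field_simp
    linarith
  have hNη : N * η ≤ 5 * k ^ 2 := by
    have h1 : 2 / ρ * η = 4 * k ^ 2 := by
      rw [hρ]; field_simp; ring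
    nlinarith
  obtain ⟨R, hR⟩ := exists_nat_ge (2 * k / η)
  obtain ⟨A', B', hnear, hsat⟩ := saturate hμ hε0 hne hc N hN0' hNρ (by
    intro p hp1 hpN r
    refine hres p hp1 ?_ r
    refine le_trans ?_ hNη
    gcongr) (Finset.univ ×ˢ Finset.Icc (0:ℤ) R)
  suffices H : ∃ n0 : ℤ, ∀ n ≥ n0, InSum A' B' n by
    obtain ⟨n0, h0⟩ := H
    exact ⟨n0, fun n hn => hnear.reach.desc.sum n (h0 n hn)⟩
  obtain ⟨K, hK⟩ := hnear.reach.cond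
  set F : ℕ → ℝ := fun m => tot A' B' m - (1 + η / 2) * m with hF
  have hlow : ∀ m : ℕ, η / 2 * m - K ≤ k * cnt (records F) m := by
    apply records_cnt F k (η/2) K
    · simp [hF, tot, cnt_zero]
    · linarith
    · intro m
      have := tot_succ_le A' B' m
      simp only [hF]
      push_cast
      linarith
    · positivity
    · intro m
      have := hK m
      simp only [hF, tot]
      linarith
  have hmu : η / (2 * k) ≤ μ (records F) := by
    apply hμ.lower _ _ (K / k)
    intro m
    have := hlow m
    rw [show η / (2 * k) * m - K / k = (η / 2 * m - K) / k by field_simp]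
    rw [div_le_iff₀ (by linarith)]
    linarith
  have hex : ∃ x : ℕ, (∀ y, x < y → F x < F y) ∧ ∃ j, (x:ℤ) ∈ B' j ∧ ρ ≤ μ (B' j) := by
    by_contra hcon
    push Not at hcon
    have hsub : records F ⊆ ⋃ j ∈ Finset.univ.filter (fun j => μ (B' j) < ρ), B' j := by
      rintro z ⟨x, rfl, hx⟩
      have : ∃ j, (x:ℤ) ∈ B' j := by
        by_contra hno
        push Not at hno
        have h1 := hx (x+1) (by omega)
        have h2 : (cnt A' (x+1) : ℝ) ≤ cnt A' x + 1 := by exact_mod_cast cnt_succ_le A' x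
        simp only [hF, tot, cnt_succ_notMem _ _ (hno _)] at h1
        push_cast at h1
        linarith
      obtain ⟨j, hj⟩ := this
      simp only [Set.mem_iUnion, Finset.mem_filter, Finset.mem_univ, true_and]
      exact ⟨j, hcon x hx j hj, hj⟩
    have h1 := (hμ.mono _ _ hsub).trans (hμ.biUnion_le _ _)
    have h2 : ∑ j ∈ Finset.univ.filter (fun j => μ (B' j) < ρ), μ (B' j) ≤ (k - 1) * ρ := by
      refine (Finset.sum_le_card_nsmul _ _ ρ ?_).trans ?_
      · intro j hj
        exact (Finset.mem_filter.mp hj).2.le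
      · rw [nsmul_eq_mul]
        gcongr
        rw [hk, add_sub_cancel_right]
        exact_mod_cast Finset.card_filter_le _ _
    have h3 : η / (2 * k) = k * ρ := by
      rw [hρ]; field_simp
    linarith
  obtain ⟨x, hx, j, hj, hthick⟩ := hex
  apply finish A' B' hnear.reach.ne (η / 2) (by positivity) x R
  · rw [← hk]
    rw [div_le_iff₀ hη] at hR
    linarith
  · intro e he
    have := hsat (j, (e:ℤ)) (by simp; omega)
    rcases this with h | h
    · exact absurd h (not_lt.mpr hthick)
    · exact h x hj
  · exact hx

end
end NashPf

namespace NashPf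
section
variable {ι : Type} [Fintype ι] [DecidableEq ι]

lemma exists_max_nat {α : Type} (P : α → Prop) (f : α → ℕ) (G : ℕ) (hf : ∀ x, f x ≤ G) (x0 : α)
    (h0 : P x0) : ∃ x, P x ∧ ∀ y, P y → f y ≤ f x := by
  obtain ⟨x, hx, hmin⟩ := (measure fun x => G - f x).wf.has_min {x | P x} ⟨x0, h0⟩
  refine ⟨x, hx, fun y hy => ?_⟩
  have h1 : ¬ (G - f y < G - f x) := hmin y hy
  have := hf x
  have := hf y
  omega

/-- a set periodic mod `G`, its stabilizer -/
def stabZ (X : Set ℤ) (G : ℕ) (hG : 0 < G) (hX : ∀ x ∈ X, ∀ t : ℤ, x + G * t ∈ X) : AddSubgroup ℤ where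
  carrier := {z | ∀ x ∈ X, x + z ∈ X}
  add_mem' := by
    intro a b ha hb x hx
    rw [← add_assoc]
    exact hb _ (ha _ hx)
  zero_mem' := by intro x hx; simpa using hx
  neg_mem' := by
    intro a ha x hx
    have h1 : ∀ n : ℕ, x + n * a ∈ X := by
      intro n
      induction n with
      | zero => simpa using hx
      | succ n ih =>
        have := ha _ ih
        rwa [show x + n * a + a = x + ((n + 1 : ℕ):ℤ) * a by push_cast; ring] at this
    have h2 := hX _ (h1 (G - 1)) (-a)
    rwa [show x + ((G - 1 : ℕ):ℤ) * a + G * (-a) = x + -a by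
      rw [Nat.cast_sub hG]; push_cast; ring] at h2

lemma exists_gamma (X : Set ℤ) (G : ℕ) (hG : 0 < G) (hX : ∀ x ∈ X, ∀ t : ℤ, x + G * t ∈ X) :
    ∃ γ : ℕ, 0 < γ ∧ γ ∣ G ∧ (∀ z : ℤ, (∀ x ∈ X, x + z ∈ X) ↔ (γ:ℤ) ∣ z) := by
  obtain ⟨a, ha⟩ := Int.subgroup_cyclic (stabZ X G hG hX)
  have hmem : ∀ z : ℤ, (∀ x ∈ X, x + z ∈ X) ↔ ((a.natAbs:ℕ):ℤ) ∣ z := by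
    intro z
    change z ∈ stabZ X G hG hX ↔ _
    rw [ha, ← AddSubgroup.zmultiples_eq_closure, Int.mem_zmultiples_iff, Int.natAbs_dvd]
  have hGd : a.natAbs ∣ G := by
    have := (hmem (G:ℤ)).mp (fun x hx => by simpa using hX x hx 1)
    exact_mod_cast this
  exact ⟨a.natAbs, Nat.pos_of_dvd_of_pos hGd hG, hGd, hmem⟩

lemma cnt_dil_sub (S : Set ℤ) (γ : ℕ) (hγ : 0 < γ) (hS : ∀ z ∈ S, (γ:ℤ) ∣ z) (m : ℕ) :
    cnt S (γ * m) ≤ cnt {n | (γ:ℤ) * n ∈ S} m := by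
  classical
  unfold cnt
  have h1 : ((Finset.Ico (0:ℤ) ((γ * m : ℕ):ℤ)).filter (fun z => z ∈ S)) ⊆
      ((Finset.Ico (0:ℤ) m).filter (fun z => z ∈ {n | (γ:ℤ) * n ∈ S})).image (fun n => (γ:ℤ) * n) := by
    intro z hz
    simp only [Finset.mem_filter, Finset.mem_Ico, Finset.mem_image, Set.mem_ofPred_eq] at hz ⊢
    obtain ⟨t, rfl⟩ := hS z hz.2
    have hγ' : (0:ℤ) < γ := by exact_mod_cast hγ
    refine ⟨t, ⟨⟨?_, ?_⟩, hz.2⟩, rfl⟩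
    · exact nonneg_of_mul_nonneg_right hz.1.1 hγ'
    · have := hz.1.2
      push_cast at this
      exact lt_of_mul_lt_mul_left this hγ'.le
  refine (Finset.card_le_card h1).trans (Finset.card_image_le.trans ?_)
  convert le_rfl using 3

lemma cnt_mult (γ : ℕ) (hγ : 0 < γ) (m : ℕ) : m ≤ cnt {z : ℤ | (γ:ℤ) ∣ z} (γ * m) := by
  classical
  unfold cnt
  have h1 : (Finset.Ico (0:ℤ) m).image (fun n => (γ:ℤ) * n) ⊆
      ((Finset.Ico (0:ℤ) ((γ * m : ℕ):ℤ)).filter (fun z => z ∈ {z : ℤ | (γ:ℤ) ∣ z})) := by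
    intro z hz
    simp only [Finset.mem_filter, Finset.mem_Ico, Finset.mem_image, Set.mem_ofPred_eq] at hz ⊢
    obtain ⟨t, ht, rfl⟩ := hz
    have hγ' : (0:ℤ) < γ := by exact_mod_cast hγ
    refine ⟨⟨mul_nonneg hγ'.le ht.1, ?_⟩, dvd_mul_right _ _⟩
    push_cast
    exact mul_lt_mul_of_pos_left ht.2 hγ'
  have h2 := Finset.card_le_card h1
  rw [Finset.card_image_of_injective] at h2
  · rw [Int.card_Ico] at h2
    have h3 : m = ((m:ℤ) - 0).toNat := by omega
    rw [← h3] at h2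
    refine h2.trans ?_
    convert le_rfl using 3
  · intro a b hab
    have hγ' : (γ:ℤ) ≠ 0 := by exact_mod_cast hγ.ne'
    exact mul_left_cancel₀ hγ' hab

lemma cnt_dil (S : Set ℤ) (γ : ℕ) (hγ : 0 < γ) (m : ℕ) :
    cnt S (γ * m) + m ≤ cnt {n | (γ:ℤ) * n ∈ S} m + γ * m := by
  set M : Set ℤ := {z : ℤ | (γ:ℤ) ∣ z} with hM
  have h1 : cnt S (γ * m) = cnt (S ∩ M) (γ * m) + cnt (S \ M) (γ * m) := by
    rw [← cnt_union, Set.inter_union_sdiff]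
    rw [Set.disjoint_left]
    intro z h1 h2
    exact h2.2 h1.2
  have h2 : cnt (S \ M) (γ * m) + cnt M (γ * m) ≤ γ * m := by
    rw [← cnt_union]
    · exact cnt_le _ _
    · rw [Set.disjoint_left]
      intro z h1 h2
      exact h1.2 h2
  have h3 : m ≤ cnt M (γ * m) := cnt_mult γ hγ m
  have h4 := cnt_dil_sub (S ∩ M) γ hγ (fun z hz => hz.2) m
  have h5 : cnt {n | (γ:ℤ) * n ∈ S ∩ M} m ≤ cnt {n | (γ:ℤ) * n ∈ S} m :=
    cnt_mono (fun n hn => hn.1) m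
  omega

theorem thmE0 (A : Set ℤ) (B : ι → Set ℤ) (hA0 : (0:ℤ) ∈ A) (hB0 : ∀ j, (0:ℤ) ∈ B j) (η : ℝ) (hη : 0 < η)
    (hc : Cond η A B) (G : ℕ) (hG : 0 < G)
    (hdiv : ∀ q : ℕ, 1 ≤ q → q * η ≤ 5 * (Fintype.card ι + 1) ^ 2 → q ∣ G) :
    ∃ n0 : ℤ, ∀ n ≥ n0, (G:ℤ) ∣ n → InSum A B n := by
  classical
  have : NeZero G := ⟨hG.ne'⟩
  set res : Set ℤ → Set (ZMod G) := fun S => (fun z : ℤ => (z : ZMod G)) '' S with hres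
  obtain ⟨⟨A', B'⟩, ⟨hr, hA', hB'⟩, hmax⟩ := exists_max_nat
    (fun p : Set ℤ × (ι → Set ℤ) => Reach η A B p.1 p.2 ∧ 0 ∈ p.1 ∧ ∀ j, 0 ∈ p.2 j)
    (fun p => (res p.1).ncard) G (fun p => by
      have := Set.ncard_le_card (res p.1)
      simpa using this) (A, B) ⟨⟨Desc.refl _ _, fun j => ⟨0, hB0 j⟩, hc⟩, hA0, hB0⟩
  simp only at hr hA' hB' hmax
  set X : Set ℤ := {z | ∃ a ∈ A', (G:ℤ) ∣ z - a} with hX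
  have hXper : ∀ x ∈ X, ∀ t : ℤ, x + G * t ∈ X := by
    rintro x ⟨a, ha, hd⟩ t
    refine ⟨a, ha, ?_⟩
    rw [show x + G * t - a = (x - a) + G * t by ring]
    exact dvd_add hd (dvd_mul_right _ _)
  have hstab : ∀ j, ∀ b ∈ B' j, ∀ x ∈ X, x + b ∈ X := by
    rintro j b hb x ⟨a, ha, hd⟩
    have h0 : (0:ℤ) ∈ mvB A' (B' j) a := ⟨hB' j, by simpa using ha⟩
    have hmv := hmax (mvA A' (B' j) a, Function.update B' j (mvB A' (B' j) a))
      ⟨reach_move hr j a ⟨0, h0⟩, Or.inl hA', by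
        intro i
        by_cases hij : i = j
        · subst hij; simpa using h0
        · simp only [Function.update_of_ne hij]; exact hB' i⟩
    simp only at hmv
    have hsub : res A' ⊆ res (mvA A' (B' j) a) := Set.image_mono Set.subset_union_left
    have heq := Set.eq_of_subset_of_ncard_le hsub hmv (Set.toFinite _)
    have hin : ((b + a : ℤ) : ZMod G) ∈ res (mvA A' (B' j) a) :=
      ⟨b + a, Or.inr (by simpa using hb), rfl⟩
    rw [← heq] at hin
    obtain ⟨a', ha', hcast⟩ := hin
    refine ⟨a', ha', ?_⟩
    have h1 := (ZMod.intCast_eq_intCast_iff_dvd_sub _ _ _).mp hcast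
    rw [show x + b - a' = (x - a) + (b + a - a') by ring]
    exact dvd_add hd h1
  obtain ⟨γ, hγ0, hγG, hγ⟩ := exists_gamma X G hG hXper
  have hBγ : ∀ j, ∀ b ∈ B' j, (γ:ℤ) ∣ b := fun j b hb => (hγ b).mp (hstab j b hb)
  have hγr : (0:ℝ) < γ := by exact_mod_cast hγ0
  have hX0 : (0:ℤ) ∈ X := ⟨0, hA', by simp⟩
  obtain ⟨n0, hn0⟩ := thmD {n | (γ:ℤ) * n ∈ A'} (fun j => {n | (γ:ℤ) * n ∈ B' j})
    (fun j => ⟨0, by simpa using hB' j⟩) (γ * η) (by positivity) (by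
      obtain ⟨K, hK⟩ := hr.cond
      refine ⟨K, fun m => ?_⟩
      have h1 := hK (γ * m)
      have h2 : (cnt A' (γ * m) : ℝ) + m ≤ cnt {n | (γ:ℤ) * n ∈ A'} m + γ * m := by
        exact_mod_cast cnt_dil A' γ hγ0 m
      have h3 : ∑ j, (cnt (B' j) (γ * m) : ℝ) ≤ ∑ j, (cnt {n | (γ:ℤ) * n ∈ B' j} m : ℝ) := by
        apply Finset.sum_le_sum
        intro j _
        exact_mod_cast cnt_dil_sub (B' j) γ hγ0 (hBγ j) m
      push_cast at h1
      linarith) (by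
      intro p hp1 hp r
      have hpG : p * γ ∣ G := by
        apply hdiv _ (Nat.mul_pos hp1 hγ0)
        push_cast
        linarith
      have h1 : (γ:ℤ) * r ∈ X := by
        have := (hγ (γ * r)).mpr (dvd_mul_right _ _) 0 hX0
        simpa using this
      obtain ⟨a', ha', hd⟩ := h1
      have hpG' : (p:ℤ) * γ ∣ G := by exact_mod_cast hpG
      have hγG' : (γ:ℤ) ∣ G := by exact_mod_cast hγG
      have h2 : (γ:ℤ) ∣ a' := by
        have := hγG'.trans hd
        rwa [dvd_sub_right (dvd_mul_right _ _)] at this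
      obtain ⟨a, rfl⟩ := h2
      refine ⟨a, ha', ?_⟩
      have h3 := hpG'.trans hd
      rw [← mul_sub, mul_comm (p:ℤ)] at h3
      exact Int.dvd_of_mul_dvd_mul_left (by exact_mod_cast hγ0.ne') h3)
  refine ⟨γ * n0, fun n hn hd => ?_⟩
  have hγG' : (γ:ℤ) ∣ G := by exact_mod_cast hγG
  obtain ⟨t, rfl⟩ := hγG'.trans hd
  have ht : n0 ≤ t := le_of_mul_le_mul_left hn (by exact_mod_cast hγ0)
  obtain ⟨a, ha, b, hb, hab⟩ := hn0 t ht
  apply hr.desc.sum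
  refine ⟨γ * a, ha, fun j => γ * b j, hb, ?_⟩
  rw [← Finset.mul_sum, ← mul_add, hab]

theorem thmE (A : Set ℤ) (B : ι → Set ℤ) (η : ℝ) (hη : 0 < η) (hc : Cond η A B)
    (hres : ∀ g : ℕ, 1 ≤ g → ∀ r : ℤ, ∃ n, InSum A B n ∧ (g:ℤ) ∣ r - n) :
    ∃ n0 : ℤ, ∀ n ≥ n0, InSum A B n := by
  classical
  set C : ℝ := 5 * (Fintype.card ι + 1) ^ 2 with hC
  set G : ℕ := (⌊C / η⌋₊).factorial with hG
  have hG0 : 0 < G := Nat.factorial_pos _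
  have hdiv : ∀ q : ℕ, 1 ≤ q → q * η ≤ C → q ∣ G := by
    intro q hq1 hq
    apply Nat.dvd_factorial hq1
    apply Nat.le_floor
    rwa [le_div_iff₀ hη]
  have key : ∀ r : ℤ, ∃ n1 : ℤ, ∀ n ≥ n1, (G:ℤ) ∣ r - n → InSum A B n := by
    intro r
    obtain ⟨s, ⟨a, ha, b, hb, hs⟩, hd⟩ := hres G hG0 r
    obtain ⟨n0, hn0⟩ := thmE0 {z | z + a ∈ A} (fun j => {z | z + b j ∈ B j}) (by simpa using ha)
      (by intro j; simpa using hb j) η hη (by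
        obtain ⟨K, hK⟩ := hc
        refine ⟨K + a.natAbs + ∑ j, ((b j).natAbs : ℝ), fun m => ?_⟩
        have h1 := hK m
        have hsh : ∀ (S : Set ℤ) (e : ℤ), (cnt S m : ℝ) ≤ cnt {z | z + e ∈ S} m + e.natAbs := by
          intro S e
          have := cnt_shift S (-e) m
          simp only [sub_neg_eq_add, Int.natAbs_neg] at this
          exact_mod_cast this
        have h2 := hsh A a
        have h3 : ∑ j, (cnt (B j) m : ℝ) ≤ ∑ j, ((cnt {z | z + b j ∈ B j} m : ℝ) + (b j).natAbs) :=
          Finset.sum_le_sum (fun j _ => hsh (B j) (b j))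
        rw [Finset.sum_add_distrib] at h3
        linarith) G hG0 hdiv
    refine ⟨n0 + s, fun n hn hdn => ?_⟩
    obtain ⟨a', ha', b', hb', hs'⟩ := hn0 (n - s) (by linarith) (by
      rw [show n - s = (r - s) - (r - n) by ring]
      exact dvd_sub hd hdn)
    refine ⟨a' + a, ha', fun j => b' j + b j, hb', ?_⟩
    rw [Finset.sum_add_distrib]
    linarith
  choose n1 hn1 using key
  refine ⟨∑ r ∈ Finset.range G, |n1 r|, fun n hn => ?_⟩
  have hGz : (0:ℤ) < G := by exact_mod_cast hG0
  have hm0 := Int.emod_nonneg n hGz.ne'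
  have hm1 := Int.emod_lt_of_pos n hGz
  apply hn1 (((n % G).toNat : ℕ) : ℤ)
  · refine (le_abs_self _).trans (le_trans ?_ hn)
    exact Finset.single_le_sum (f := fun r : ℕ => |n1 r|) (fun _ _ => abs_nonneg _)
      (Finset.mem_range.mpr (by omega))
  · rw [Int.toNat_of_nonneg hm0]
    have := Int.dvd_self_sub_emod (x := n) (m := (G:ℤ))
    have h2 := (dvd_neg (α := ℤ)).mpr this
    rwa [neg_sub] at h2

end
end NashPf

namespace NashPf
section
variable {ι : Type} [Fintype ι] [DecidableEq ι]
variable {V : Type} [AddCommGroup V] [Fintype V] [DecidableEq V]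

def InSumF (X : Finset V) (D : ι → Finset V) (v : V) : Prop :=
  ∃ x ∈ X, ∃ d : ι → V, (∀ j, d j ∈ D j) ∧ x + ∑ j, d j = v

lemma moveF (X : Finset V) (D : ι → Finset V) (j : ι) (e : V) (v : V)
    (h : InSumF (X ∪ (D j).image (· + e)) (Function.update D j ((D j).filter (fun d => d + e ∈ X))) v) :
    InSumF X D v := by
  have hsub : ∀ i, Function.update D j ((D j).filter (fun d => d + e ∈ X)) i ⊆ D i := by
    intro i
    by_cases hij : i = j
    · subst hij; rw [Function.update_self]; exact Finset.filter_subset _ _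
    · rw [Function.update_of_ne hij]
  obtain ⟨a, ha, b, hb, hab⟩ := h
  rcases Finset.mem_union.mp ha with ha | ha
  · exact ⟨a, ha, b, fun i => hsub i (hb i), hab⟩
  · have hj := hb j
    rw [Function.update_self, Finset.mem_filter] at hj
    obtain ⟨d, hd, rfl⟩ := Finset.mem_image.mp ha
    refine ⟨b j + e, hj.2, Function.update b j d, ?_, ?_⟩
    · intro i
      by_cases hij : i = j
      · subst hij; rw [Function.update_self]; exact hd
      · rw [Function.update_of_ne hij]; exact hsub i (hb i)
    · rw [← hab, Finset.sum_update_of_mem (Finset.mem_univ j),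
          ← Finset.add_sum_erase _ b (Finset.mem_univ j), Finset.erase_eq]
      abel

lemma moveF_card (X : Finset V) (D : ι → Finset V) (j : ι) (e : V) :
    X.card + ∑ i, (D i).card ≤ (X ∪ (D j).image (· + e)).card +
      ∑ i, (Function.update D j ((D j).filter (fun d => d + e ∈ X)) i).card := by
  rw [← Finset.add_sum_erase _ _ (Finset.mem_univ j),
    ← Finset.add_sum_erase (a := j) _ (fun i => (Function.update D j ((D j).filter (fun d => d + e ∈ X)) i).card) (Finset.mem_univ j)]
  have h1 : ∑ i ∈ Finset.univ.erase j, (Function.update D j ((D j).filter (fun d => d + e ∈ X)) i).card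
      = ∑ i ∈ Finset.univ.erase j, (D i).card := by
    apply Finset.sum_congr rfl
    intro i hi
    rw [Function.update_of_ne (Finset.ne_of_mem_erase hi)]
  rw [h1, Function.update_self]
  have h2 := Finset.card_filter_add_card_filter_not (s := D j) (fun d => d + e ∈ X)
  have h3 : X.card + ((D j).filter (fun d => ¬ d + e ∈ X)).card ≤ (X ∪ (D j).image (· + e)).card := by
    rw [← Finset.card_image_of_injective ((D j).filter (fun d => ¬ d + e ∈ X)) (add_left_injective e),
      ← Finset.card_union_of_disjoint]
    · apply Finset.card_le_card
      apply Finset.union_subset_union_right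
      exact Finset.image_subset_image (Finset.filter_subset _ _)
    · rw [Finset.disjoint_left]
      intro z hz hz'
      obtain ⟨d, hd, rfl⟩ := Finset.mem_image.mp hz'
      exact (Finset.mem_filter.mp hd).2 hz
  omega

lemma satF (C : ι → Finset V) (hC : ∀ j, (C j).Nonempty) :
    ∃ (X : Finset V) (D : ι → Finset V), X.Nonempty ∧ (∀ v, InSumF X D v → InSumF {0} C v) ∧
      (∀ j, (D j).Nonempty) ∧ 1 + ∑ j, (C j).card ≤ X.card + ∑ j, (D j).card ∧
      ∀ j, ∀ d ∈ D j, ∀ d' ∈ D j, ∀ x ∈ X, x + (d' - d) ∈ X := by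
  obtain ⟨⟨X, D⟩, ⟨h1, h2, h3, h4⟩, hmax⟩ := exists_max_nat
    (fun p : Finset V × (ι → Finset V) => p.1.Nonempty ∧ (∀ v, InSumF p.1 p.2 v → InSumF {0} C v) ∧
      (∀ j, (p.2 j).Nonempty) ∧ 1 + ∑ j, (C j).card ≤ p.1.card + ∑ j, (p.2 j).card)
    (fun p => p.1.card) (Fintype.card V) (fun p => Finset.card_le_univ _) ({0}, C)
    ⟨by simp, fun _ h => h, hC, by simp⟩
  simp only at h1 h2 h3 h4 hmax
  refine ⟨X, D, h1, h2, h3, h4, ?_⟩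
  intro j d hd d' hd' x hx
  have hd2 : d ∈ (D j).filter (fun z => z + (x - d) ∈ X) := by
    rw [Finset.mem_filter]
    refine ⟨hd, ?_⟩
    rwa [add_sub_cancel]
  have hm := hmax (X ∪ (D j).image (· + (x - d)),
    Function.update D j ((D j).filter (fun z => z + (x - d) ∈ X)))
    ⟨h1.mono Finset.subset_union_left, fun v hv => h2 v (moveF _ _ _ _ _ hv), by
      intro i
      by_cases hij : i = j
      · subst hij; simp only [Function.update_self]; exact ⟨d, hd2⟩
      · simp only [Function.update_of_ne hij]; exact h3 i, h4.trans (moveF_card _ _ _ _)⟩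
  simp only at hm
  have heq := Finset.eq_of_subset_of_card_le (Finset.subset_union_left (s₁ := X)
    (s₂ := (D j).image (· + (x - d)))) hm
  rw [heq]
  apply Finset.mem_union_right
  rw [Finset.mem_image]
  exact ⟨d', hd', by abel⟩

lemma growF (T H Bb : Finset V) (hT : T.Nonempty) (hTH : ∀ t ∈ T, ∀ z ∈ H, t + z ∈ T)
    (hB : Bb.Nonempty)
    (n : ℕ) (hspan : ∀ v : V, ∃ f : Fin n → V, (∀ i, f i ∈ Bb) ∧ ∑ i, f i = v) :
    T.card + H.card ≤ (Finset.image₂ (· + ·) T Bb).card ∨ T = Finset.univ := by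
  obtain ⟨b0, hb0⟩ := hB
  have hsub0 : T.image (· + b0) ⊆ Finset.image₂ (· + ·) T Bb := by
    intro z hz
    obtain ⟨t, ht, rfl⟩ := Finset.mem_image.mp hz
    exact Finset.mem_image₂_of_mem ht hb0
  by_cases hall : ∀ t ∈ T, ∀ b ∈ Bb, t + b - b0 ∈ T
  · right
    have key : ∀ (n : ℕ) (f : Fin n → V), (∀ i, f i ∈ Bb) → ∀ t ∈ T, t + ∑ i, f i - n • b0 ∈ T := by
      intro n
      induction n with
      | zero => intro f _ t ht; simpa using ht
      | succ n ih =>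
        intro f hf t ht
        have h1 := ih (fun i => f i.succ) (fun i => hf _) (t + f 0 - b0) (hall t ht _ (hf 0))
        rw [Fin.sum_univ_succ]
        convert h1 using 1
        rw [succ_nsmul]
        abel
    obtain ⟨t, ht⟩ := hT
    ext v
    simp only [Finset.mem_univ, iff_true]
    obtain ⟨f, hf, hfv⟩ := hspan (v - t + n • b0)
    have := key n f hf t ht
    rw [hfv] at this
    convert this using 1
    abel
  · left
    push Not at hall
    obtain ⟨t, ht, b, hb, hnot⟩ := hall
    rw [← Finset.card_image_of_injective T (add_left_injective b0),
      ← Finset.card_image_of_injective H (add_right_injective (t + b)), ← Finset.card_union_of_disjoint]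
    · apply Finset.card_le_card
      apply Finset.union_subset hsub0
      intro z hz
      obtain ⟨y, hy, rfl⟩ := Finset.mem_image.mp hz
      rw [show t + b + y = (t + y) + b by abel]
      exact Finset.mem_image₂_of_mem (hTH t ht y hy) hb
    · rw [Finset.disjoint_left]
      intro z hz hz'
      obtain ⟨t1, ht1, rfl⟩ := Finset.mem_image.mp hz
      obtain ⟨y, hy, hyz⟩ := Finset.mem_image.mp hz'
      have h1 : T.image (· + y) ⊆ T := by
        intro w hw
        obtain ⟨t2, ht2, rfl⟩ := Finset.mem_image.mp hw
        exact hTH t2 ht2 y hy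
      have h2 := Finset.eq_of_subset_of_card_le h1 (by
        rw [Finset.card_image_of_injective _ (add_left_injective y)])
      rw [← h2] at ht1
      obtain ⟨t3, ht3, rfl⟩ := Finset.mem_image.mp ht1
      apply hnot
      have : t + b - b0 = t3 := by
        have h5 : t + b + y - y - b0 = t3 + y + b0 - y - b0 := by rw [hyz]
        have h6 : t + b + y - y - b0 = t + b - b0 := by abel
        have h7 : t3 + y + b0 - y - b0 = t3 := by abel
        rw [← h6, h5, h7]
      rw [this]; exact ht3

lemma fillF (H Bb : Finset V) (hB : Bb.Nonempty)
    (n : ℕ) (hspan : ∀ v : V, ∃ f : Fin n → V, (∀ i, f i ∈ Bb) ∧ ∑ i, f i = v) (W : ℕ) :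
    ∀ T : Finset V, T.Nonempty → (∀ t ∈ T, ∀ z ∈ H, t + z ∈ T) → Fintype.card V ≤ T.card + W * H.card →
    ∀ v, ∃ t ∈ T, ∃ f : Fin W → V, (∀ i, f i ∈ Bb) ∧ t + ∑ i, f i = v := by
  induction W with
  | zero =>
    intro T hT hTH hc v
    have : T = Finset.univ := by
      apply Finset.eq_univ_of_card
      have := Finset.card_le_univ T
      omega
    exact ⟨v, by simp [this], Fin.elim0, fun i => i.elim0, by simp⟩
  | succ W ih =>
    intro T hT hTH hc v
    have hcard : Fintype.card V ≤ (Finset.image₂ (· + ·) T Bb).card + W * H.card := by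
      rcases growF T H Bb hT hTH hB n hspan with h | h
      · rw [add_mul] at hc; omega
      · have h1 : T.card ≤ (Finset.image₂ (· + ·) T Bb).card := by
          obtain ⟨b0, hb0⟩ := hB
          rw [← Finset.card_image_of_injective T (add_left_injective b0)]
          apply Finset.card_le_card
          intro z hz
          obtain ⟨t, ht, rfl⟩ := Finset.mem_image.mp hz
          exact Finset.mem_image₂_of_mem ht hb0
        rw [h, Finset.card_univ] at h1
        rw [h]
        omega
    obtain ⟨t', ht', f, hf, hv⟩ := ih (Finset.image₂ (· + ·) T Bb) (hT.image₂ hB) (by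
      intro w hw z hz
      obtain ⟨t, ht, b, hb, rfl⟩ := Finset.mem_image₂.mp hw
      rw [show t + b + z = (t + z) + b by abel]
      exact Finset.mem_image₂_of_mem (hTH t ht z hz) hb) hcard v
    obtain ⟨t, ht, b, hb, rfl⟩ := Finset.mem_image₂.mp ht'
    refine ⟨t, ht, Fin.cons b f, ?_, ?_⟩
    · intro i
      refine Fin.cases ?_ ?_ i
      · simpa using hb
      · intro i; simpa using hf i
    · rw [Fin.sum_univ_succ]
      simp only [Fin.cons_zero, Fin.cons_succ]
      rw [← hv]
      abel

theorem lemmaF (C : ι → Finset V) (hC : ∀ j, (C j).Nonempty) (hsum : Fintype.card V ≤ ∑ j, (C j).card)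
    (Bb : Finset V) (hB : Bb.Nonempty)
    (n : ℕ) (hspan : ∀ v : V, ∃ f : Fin n → V, (∀ i, f i ∈ Bb) ∧ ∑ i, f i = v) (v : V) :
    ∃ (f : Fin (Fintype.card ι) → V) (c : ι → V), (∀ i, f i ∈ Bb) ∧ (∀ j, c j ∈ C j) ∧
      ∑ i, f i + ∑ j, c j = v := by
  obtain ⟨X, D, hX, hsub, hD, hcard, hst⟩ := satF C hC
  set H : Finset V := Finset.univ.filter (fun z => ∀ x ∈ X, x + z ∈ X) with hH
  choose d hd using hD
  have hDH : ∀ j, (D j).card ≤ H.card := by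
    intro j
    rw [← Finset.card_image_of_injective (D j) (sub_left_injective (b := d j))]
    apply Finset.card_le_card
    intro z hz
    obtain ⟨d', hd', rfl⟩ := Finset.mem_image.mp hz
    rw [hH, Finset.mem_filter]
    exact ⟨Finset.mem_univ _, hst j (d j) (hd j) d' hd'⟩
  have h1 : ∑ j, (D j).card ≤ Fintype.card ι * H.card := by
    have := Finset.sum_le_card_nsmul Finset.univ (fun j => (D j).card) H.card (fun j _ => hDH j)
    simpa using this
  obtain ⟨t, ht, f, hf, hv⟩ := fillF H Bb hB n hspan (Fintype.card ι) X hX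
    (fun t ht z hz => (Finset.mem_filter.mp hz).2 t ht) (by omega) (v - ∑ j, d j)
  obtain ⟨x0, hx0, c, hc, hs⟩ := hsub (t + ∑ j, d j) ⟨t, ht, d, hd, rfl⟩
  rw [Finset.mem_singleton] at hx0
  subst hx0
  rw [zero_add] at hs
  refine ⟨f, c, hf, hc, ?_⟩
  rw [hs, ← sub_eq_zero, ← sub_eq_zero.mpr hv]
  abel

end
end NashPf

namespace NashPf

lemma numeric_w (k h : ℕ) : ∑ i ∈ Finset.range h, Nat.multichoose (k+1) i = (h + k).choose (k + 1) := by
  induction h with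
  | zero => simp
  | succ h ih =>
    rw [Finset.sum_range_succ, ih, Nat.multichoose_eq]
    have h1 : (k + 1 + h - 1).choose h = (h + k).choose k := by
      rw [show k + 1 + h - 1 = h + k by omega]
      exact Nat.choose_symm_add
    rw [h1, show h + 1 + k = (h + k) + 1 by ring, Nat.choose_succ_succ]
    ring

lemma numeric_l (k h : ℕ) : ∑ i ∈ Finset.range h, (h - i) * Nat.multichoose (k+1) i = (h + k + 1).choose (k + 2) := by
  induction h with
  | zero => simp
  | succ h ih =>
    have h1 : ∑ i ∈ Finset.range (h+1), (h + 1 - i) * Nat.multichoose (k+1) i =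
        ∑ i ∈ Finset.range (h+1), ((h - i) * Nat.multichoose (k+1) i + Nat.multichoose (k+1) i) := by
      apply Finset.sum_congr rfl
      intro i hi
      rw [Finset.mem_range] at hi
      rw [show h + 1 - i = (h - i) + 1 by omega]
      ring
    rw [h1, Finset.sum_add_distrib, numeric_w, Finset.sum_range_succ, ih,
      show h + 1 + k + 1 = (h + k + 1) + 1 by ring, Nat.choose_succ_succ (h+k+1) (k+1),
      show h + 1 + k = h + k + 1 by ring]
    simp
    ring

lemma numeric_final (k h : ℕ) (hk : 1 ≤ k) (hh : 1 ≤ h) :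
    (((∑ i ∈ Finset.range h, Nat.multichoose k i) + ∑ i ∈ Finset.range h, (h - i) * Nat.multichoose k i : ℕ) : ℤ)
      = (h + 1) * Nat.choose (h + k - 1) k - k * Nat.choose (h + k - 1) (k + 1) := by
  obtain ⟨k, rfl⟩ : ∃ k', k = k' + 1 := ⟨k - 1, by omega⟩
  obtain ⟨h, rfl⟩ : ∃ h', h = h' + 1 := ⟨h - 1, by omega⟩
  rw [numeric_w, numeric_l]
  rw [show h + 1 + (k + 1) - 1 = h + 1 + k by omega, Nat.choose_succ_succ (h+1+k) (k+1)]
  have h1 := Nat.choose_succ_right_eq (h+1+k) (k+1)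
  rw [show h + 1 + k - (k + 1) = h by omega] at h1
  have h2 : ((h+1+k).choose (k+1+1) : ℤ) * (k + 1 + 1) = (h+1+k).choose (k+1) * h := by exact_mod_cast h1
  push_cast
  have h3 : k.succ + 1 = k + 1 + 1 := rfl
  simp only [Nat.succ_eq_add_one] at *
  linarith

lemma foldSum_zero (S : Set ℤ) : (0:ℤ) ∈ foldSum 0 S := ⟨Fin.elim0, fun i => i.elim0, by simp⟩

lemma foldSum_succ {S : Set ℤ} {n : ℕ} {z : ℤ} : z ∈ foldSum (n+1) S ↔ ∃ a ∈ S, ∃ w ∈ foldSum n S, z = a + w := by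
  constructor
  · rintro ⟨f, hf, rfl⟩
    exact ⟨f 0, hf 0, ∑ i : Fin n, f i.succ, ⟨fun i => f i.succ, fun i => hf _, rfl⟩, Fin.sum_univ_succ f⟩
  · rintro ⟨a, ha, w, ⟨f, hf, rfl⟩, rfl⟩
    refine ⟨Fin.cons a f, ?_, ?_⟩
    · intro i
      refine Fin.cases ?_ ?_ i
      · simpa using ha
      · intro i; simpa using hf i
    · rw [Fin.sum_univ_succ]; simp

lemma foldSum_add {S : Set ℤ} {m n : ℕ} {x y : ℤ} (hx : x ∈ foldSum m S) (hy : y ∈ foldSum n S) :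
    x + y ∈ foldSum (m + n) S := by
  induction m generalizing x with
  | zero =>
    obtain ⟨f, _, rfl⟩ := hx
    simpa using hy
  | succ m ih =>
    obtain ⟨a, ha, w, hw, rfl⟩ := foldSum_succ.mp hx
    rw [show m + 1 + n = (m + n) + 1 by ring, foldSum_succ]
    exact ⟨a, ha, w + y, ih hw, by ring⟩

lemma foldSum_const {S : Set ℤ} (b : ℤ) (hb : b ∈ S) (n : ℕ) : n * b ∈ foldSum n S :=
  ⟨fun _ => b, fun _ => hb, by simp⟩

lemma foldSum_sum {ι : Type} (s : Finset ι) (S : Set ℤ) (n : ι → ℕ) (x : ι → ℤ)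
    (hx : ∀ i ∈ s, x i ∈ foldSum (n i) S) : ∑ i ∈ s, x i ∈ foldSum (∑ i ∈ s, n i) S := by
  classical
  induction s using Finset.induction_on with
  | empty => simpa using foldSum_zero S
  | insert i s hi ih =>
    rw [Finset.sum_insert hi, Finset.sum_insert hi]
    exact foldSum_add (hx i (Finset.mem_insert_self _ _))
      (ih (fun j hj => hx j (Finset.mem_insert_of_mem hj)))

/-- value of a multiset of elements of `X` -/
def sv {X : Finset ℤ} {i : ℕ} (m : Sym X i) : ℤ := (Multiset.map (fun x : X => (x:ℤ)) m.1).sum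

lemma decompose (A B : Set ℤ) (X : Finset ℤ) (hAB : ∀ a ∈ A, a ∈ B ∨ a ∈ X) (h : ℕ) :
    ∀ z ∈ foldSum h A, ∃ i r : ℕ, i + r = h ∧ ∃ m : Sym X i, ∃ w ∈ foldSum r B, z = sv m + w := by
  induction h with
  | zero =>
    rintro z ⟨f, _, rfl⟩
    exact ⟨0, 0, rfl, Sym.nil, 0, foldSum_zero B, by simp [sv]⟩
  | succ h ih =>
    intro z hz
    obtain ⟨a, ha, w, hw, rfl⟩ := foldSum_succ.mp hz
    obtain ⟨i, r, hir, m, w', hw', rfl⟩ := ih w hw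
    rcases hAB a ha with haB | haX
    · refine ⟨i, r + 1, by omega, m, a + w', foldSum_succ.mpr ⟨a, haB, w', hw', rfl⟩, by ring⟩
    · refine ⟨i + 1, r, by omega, Sym.cons ⟨a, haX⟩ m, w', hw', ?_⟩
      have : sv (Sym.cons ⟨a, haX⟩ m) = a + sv m := by
        unfold sv
        change (Multiset.map (fun x : X => (x:ℤ)) (⟨a, haX⟩ ::ₘ m.1)).sum = _
        rw [Multiset.map_cons, Multiset.sum_cons]
      rw [this]
      ring

lemma cnt_iUnion_le {ι : Type} (s : Finset ι) (S : ι → Set ℤ) (m : ℕ) :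
    cnt (⋃ i ∈ s, S i) m ≤ ∑ i ∈ s, cnt (S i) m := by
  classical
  induction s using Finset.induction_on with
  | empty => simp [cnt]
  | insert i s hi ih =>
    rw [Finset.set_biUnion_insert, Finset.sum_insert hi]
    have h1 := cnt_union (S := S i) (T := (⋃ i ∈ s, S i) \ S i) Set.disjoint_sdiff_right m
    rw [Set.union_sdiff_self] at h1
    have h2 := cnt_mono (S := (⋃ i ∈ s, S i) \ S i) (T := ⋃ i ∈ s, S i) Set.sdiff_subset m
    omega

lemma cnt_cofinal (T : Set ℤ) (n1 : ℤ) (hT : ∀ n ≥ n1, n ∈ T) (m : ℕ) : m ≤ cnt T m + n1.toNat := by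
  classical
  unfold cnt
  have h1 : Finset.Ico (0:ℤ) m ⊆ (Finset.Ico (0:ℤ) m).filter (fun z => z ∈ T) ∪ Finset.Ico 0 n1 := by
    intro z hz
    rw [Finset.mem_union, Finset.mem_filter]
    by_cases h : n1 ≤ z
    · exact Or.inl ⟨hz, hT z h⟩
    · right
      rw [Finset.mem_Ico] at hz ⊢
      omega
  have h2 := (Finset.card_le_card h1).trans (Finset.card_union_le _ _)
  rw [Int.card_Ico, Int.card_Ico] at h2
  have h3 : ((m:ℤ) - 0).toNat = m := by omega
  rw [h3, sub_zero] at h2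
  refine h2.trans ?_
  convert le_rfl using 4

/-- abstract application -/
theorem core {ι : Type} [Fintype ι] (B : Set ℤ) (b0 : ℤ) (hb0 : b0 ∈ B) (h' : ℕ) (hB : RepBy B h')
    (s : ι → ℤ) (d : ι → ℕ) (hd : ∀ j, d j ≤ Fintype.card ι) (n1 : ℤ)
    (hcov : ∀ n ≥ n1, ∃ j, ∃ w ∈ foldSum (d j) B, n = s j + w) :
    RepBy B (Fintype.card ι + ∑ j, d j) := by
  classical
  set W := Fintype.card ι with hW
  have hWpos : 0 < W := by
    obtain ⟨j, _⟩ := hcov n1 le_rfl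
    exact Fintype.card_pos_iff.mpr ⟨j⟩
  have hWr : (0:ℝ) < W := by exact_mod_cast hWpos
  set Aj : ι → Set ℤ := fun j => foldSum (d j) B with hAj
  have hAne : ∀ j, (d j) * b0 ∈ Aj j := fun j => foldSum_const b0 hb0 (d j)
  have hcond : Cond (1 / W) (foldSum W B) Aj := by
    set K1 : ℕ := n1.toNat + ∑ j, (s j).natAbs with hK1
    have h1 : ∀ m : ℕ, m ≤ ∑ j, cnt (Aj j) m + K1 := by
      intro m
      have h2 := cnt_cofinal (⋃ j ∈ Finset.univ, {z | z - s j ∈ Aj j}) n1 (by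
        intro n hn
        obtain ⟨j, w, hw, rfl⟩ := hcov n hn
        simp only [Set.mem_iUnion]
        exact ⟨j, Finset.mem_univ _, by simpa using hw⟩) m
      have h3 := cnt_iUnion_le Finset.univ (fun j => {z | z - s j ∈ Aj j}) m
      have h4 : ∑ j, cnt {z | z - s j ∈ Aj j} m ≤ ∑ j, (cnt (Aj j) m + (s j).natAbs) := by
        apply Finset.sum_le_sum
        intro j _
        have := cnt_shift {z | z - s j ∈ Aj j} (-(s j)) m
        simpa using this
      rw [Finset.sum_add_distrib] at h4
      omega
    set K2 : ℕ := ∑ j, ((W - d j : ℕ) * b0 : ℤ).natAbs with hK2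
    have h5 : ∀ m : ℕ, ∑ j, cnt (Aj j) m ≤ W * cnt (foldSum W B) m + K2 := by
      intro m
      have : ∀ j, cnt (Aj j) m ≤ cnt (foldSum W B) m + ((W - d j : ℕ) * b0 : ℤ).natAbs := by
        intro j
        refine (cnt_shift (Aj j) ((W - d j : ℕ) * b0) m).trans ?_
        refine Nat.add_le_add_right (cnt_mono ?_ m) _
        intro z hz
        have := foldSum_add hz (foldSum_const b0 hb0 (W - d j))
        rw [sub_add_cancel, Nat.add_sub_cancel' (hd j)] at this
        exact this
      have h6 := Finset.sum_le_sum (s := Finset.univ) (fun j _ => this j)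
      rw [Finset.sum_add_distrib] at h6
      simpa [hW] using h6
    refine ⟨K1 + (K1 + K2) / W, fun m => ?_⟩
    have h1' : (m:ℝ) ≤ ∑ j, (cnt (Aj j) m : ℝ) + K1 := by exact_mod_cast h1 m
    have h5' : ∑ j, (cnt (Aj j) m : ℝ) ≤ W * cnt (foldSum W B) m + K2 := by exact_mod_cast h5 m
    have h7 : ((m:ℝ) - K1 - K2) / W ≤ cnt (foldSum W B) m := by
      rw [div_le_iff₀ hWr]
      linarith
    have h8 : (1 + 1 / (W:ℝ)) * m - (K1 + (K1 + K2) / W) = m - K1 + ((m:ℝ) - K1 - K2) / W := by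
      field_simp
      ring
    rw [h8]
    linarith
  have hlarge : ∀ (g : ℕ), 1 ≤ g → ∀ (n2 : ℤ) (v : ZMod g), ∃ n : ℤ, n2 ≤ n ∧ (n : ZMod g) = v := by
    intro g hg n2 v
    have : NeZero g := ⟨by omega⟩
    refine ⟨(v.val : ℤ) + g * |n2|, ?_, by simp⟩
    have h1 : (1:ℤ) ≤ g := by exact_mod_cast hg
    have h2 := le_abs_self n2
    have h3 := abs_nonneg n2
    have h4 : (0:ℤ) ≤ v.val := by positivity
    nlinarith
  obtain ⟨n0, hn0⟩ := thmE (foldSum W B) Aj (1 / W) (by positivity) hcond (by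
    intro g hg r
    have : NeZero g := ⟨by omega⟩
    let res : Set ℤ → Finset (ZMod g) := fun S => Finset.univ.filter (fun v => ∃ z ∈ S, (z : ZMod g) = v)
    have hres : ∀ S v, v ∈ res S ↔ ∃ z ∈ S, (z : ZMod g) = v := by
      intro S v; simp [res]
    obtain ⟨N2, hN2⟩ := Filter.eventually_atTop.mp hB
    obtain ⟨f, c, hf, hc, hfc⟩ := lemmaF (fun j => res (Aj j))
      (fun j => ⟨_, (hres _ _).mpr ⟨_, hAne j, rfl⟩⟩) (by
        have hsub : (Finset.univ : Finset (ZMod g)) ⊆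
            Finset.univ.biUnion (fun j => (res (Aj j)).image (fun v => (s j : ZMod g) + v)) := by
          intro v _
          obtain ⟨n, hn, rfl⟩ := hlarge g hg n1 v
          obtain ⟨j, w, hw, rfl⟩ := hcov n hn
          rw [Finset.mem_biUnion]
          refine ⟨j, Finset.mem_univ _, Finset.mem_image.mpr ⟨(w : ZMod g), (hres _ _).mpr ⟨w, hw, rfl⟩, by simp⟩⟩
        have h1 := (Finset.card_le_card hsub).trans Finset.card_biUnion_le
        refine h1.trans (Finset.sum_le_sum (fun j _ => Finset.card_image_le)))
      (res B) ⟨_, (hres _ _).mpr ⟨b0, hb0, rfl⟩⟩ h' (by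
        intro v
        obtain ⟨n, hn, rfl⟩ := hlarge g hg N2 v
        obtain ⟨f, hf, rfl⟩ := hN2 n hn
        exact ⟨fun i => (f i : ZMod g), fun i => (hres _ _).mpr ⟨_, hf i, rfl⟩, by simp⟩) (r : ZMod g)
    choose f' hf' hf'' using fun i => (hres _ _).mp (hf i)
    choose c' hc' hc'' using fun j => (hres _ _).mp (hc j)
    refine ⟨∑ i, f' i + ∑ j, c' j, ⟨_, ⟨f', hf', rfl⟩, c', hc', rfl⟩, ?_⟩
    rw [← ZMod.intCast_eq_intCast_iff_dvd_sub]
    push_cast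
    simp only [hf'', hc'', hfc])
  refine Filter.eventually_atTop.mpr ⟨n0, fun n hn => ?_⟩
  obtain ⟨a, ha, b, hb, rfl⟩ := hn0 n hn
  exact foldSum_add ha (foldSum_sum Finset.univ B d b (fun j _ => hb j))

end NashPf

theorem order_of_basis_minus_subset_le_nash
    (A : Set ℤ) (h : ℕ) (hA : IsAdditiveBasis A) (hordA : basisOrder A = h)
    (X : Finset ℤ) (hXne : X.Nonempty) (hXA : ↑X ⊆ A)
    (k : ℕ) (hk : X.card = k)
    (hB : IsAdditiveBasis (A \ ↑X)) :
    (basisOrder (A \ ↑X) : ℤ) ≤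
      (h + 1) * Nat.choose (h + k - 1) k - k * Nat.choose (h + k - 1) (k + 1) := by
  classical
  have hk1 : 1 ≤ k := by rw [← hk]; exact hXne.card_pos
  have hmem : basisOrder A ∈ {h : ℕ | 1 ≤ h ∧ RepBy A h} := by
    apply Nat.sInf_mem
    obtain ⟨_, h0, h1, h2⟩ := hA
    exact ⟨h0, h1, h2⟩
  rw [hordA] at hmem
  obtain ⟨hh1, hrep⟩ := hmem
  obtain ⟨_, h', hh', hrepB⟩ := hB
  set B : Set ℤ := A \ ↑X with hBdef
  obtain ⟨b0, hb0⟩ : ∃ b0, b0 ∈ B := by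
    obtain ⟨n, f, hf, _⟩ := hrepB.exists
    exact ⟨f ⟨0, by omega⟩, hf _⟩
  have hcardS : ∀ i, Fintype.card (Sym X i) = Nat.multichoose k i := by
    intro i
    rw [Sym.card_sym_eq_multichoose, Fintype.card_coe, hk]
  have hcard : Fintype.card (Σ i : Fin h, Sym X i) = ∑ i ∈ Finset.range h, Nat.multichoose k i := by
    rw [Fintype.card_sigma, Finset.sum_range]
    exact Finset.sum_congr rfl (fun i _ => hcardS i)
  have hsumd : ∑ j : (Σ i : Fin h, Sym X i), (h - (j.1 : ℕ)) =
      ∑ i ∈ Finset.range h, (h - i) * Nat.multichoose k i := by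
    rw [Fintype.sum_sigma, Finset.sum_range]
    refine Finset.sum_congr rfl (fun i _ => ?_)
    simp only [Finset.sum_const, Finset.card_univ, hcardS, smul_eq_mul]
    ring
  have hWh : h ≤ Fintype.card (Σ i : Fin h, Sym X i) := by
    rw [hcard]
    calc h = ∑ i ∈ Finset.range h, 1 := by simp
      _ ≤ _ := by
        apply Finset.sum_le_sum
        intro i _
        rw [Nat.multichoose_eq]
        exact Nat.choose_pos (by omega)
  obtain ⟨N1, hN1⟩ := Filter.eventually_atTop.mp hrep
  have hmain := NashPf.core (ι := Σ i : Fin h, Sym X i) B b0 hb0 h' hrepB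
    (fun j => NashPf.sv j.2) (fun j => h - (j.1 : ℕ)) (fun j => (Nat.sub_le _ _).trans hWh)
    (max N1 (∑ m : Sym X h, |NashPf.sv m| + 1)) (by
      intro n hn
      obtain ⟨i, r, hir, m, w, hw, hnw⟩ := NashPf.decompose A B X (by
        intro a ha
        by_cases haX : a ∈ X
        · exact Or.inr haX
        · exact Or.inl ⟨ha, by simpa using haX⟩) h n (hN1 n (le_trans (le_max_left _ _) hn))
      have hr : r ≠ 0 := by
        rintro rfl
        have hih : i = h := by omega
        subst hih
        obtain ⟨f, _, rfl⟩ := hw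
        have h1 : |NashPf.sv m| ≤ ∑ m : Sym X i, |NashPf.sv m| :=
          Finset.single_le_sum (f := fun m : Sym X i => |NashPf.sv m|) (fun _ _ => abs_nonneg _) (Finset.mem_univ m)
        have h2 := le_abs_self (NashPf.sv m)
        have h3 := le_trans (le_max_right _ _) hn
        simp at hnw
        omega
      refine ⟨⟨⟨i, by omega⟩, m⟩, w, ?_, hnw⟩
      simp only
      rwa [show h - i = r by omega])
  have hle : basisOrder B ≤ Fintype.card (Σ i : Fin h, Sym X i) + ∑ j : (Σ i : Fin h, Sym X i), (h - (j.1 : ℕ)) := by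
    apply Nat.sInf_le
    exact ⟨by omega, hmain⟩
  rw [hcard, hsumd] at hle
  rw [← NashPf.numeric_final k h hk1 hh1]
  exact_mod_cast hle
end

section
/- Let X be a finite nonempty set of integers and B an infinite set of integers with B ∩ {n ∈ ℤ : n < 0} finite. Set η := min{|b−b'| : b, b' ∈ B, b ≠ b', |b−b'| ≥ diam(X)}. Then for all natural numbers u, v and every positive integer g, the image of uB + vX in ℤ/gℤ has cardinality at most η times the cardinality of the image of (u+v)B in ℤ/gℤ. -/
open Pointwise

lemma foldSum_add_mem {m n : ℕ} {S : Set ℤ} {x y : ℤ} (hx : x ∈ foldSum m S)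
    (hy : y ∈ foldSum n S) : x + y ∈ foldSum (m + n) S := by
  obtain ⟨f, hf, rfl⟩ := hx
  obtain ⟨f', hf', rfl⟩ := hy
  refine ⟨Fin.append f f', fun i => ?_, ?_⟩
  · refine Fin.addCases (fun i => ?_) (fun i => ?_) i
    · simpa using hf i
    · simpa using hf' i
  · simp [Fin.sum_univ_add]

lemma foldSum_const_mem (m : ℕ) {S : Set ℤ} {b : ℤ} (hb : b ∈ S) :
    (m : ℤ) * b ∈ foldSum m S :=
  ⟨fun _ => b, fun _ => hb, by simp⟩

lemma exists_far (B : Set ℤ) (hBinf : B.Infinite) (d : ℕ) :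
    ∃ b ∈ B, ∃ b' ∈ B, b ≠ b' ∧ d ≤ (b - b').natAbs := by
  obtain ⟨b', hb'⟩ := hBinf.nonempty
  obtain ⟨b, hb, hb2⟩ := hBinf.exists_notMem_finite (Set.finite_Icc (b' - d) (b' + d))
  rw [Set.mem_Icc] at hb2
  refine ⟨b, hb, b', hb', ?_, ?_⟩ <;> omega

theorem mod_card_bound_for_uB_add_vX
    (X : Finset ℤ) (hXne : X.Nonempty)
    (B : Set ℤ) (hBinf : B.Infinite) (hBneg : {n : ℤ | n ∈ B ∧ n < 0}.Finite)
    (η : ℕ)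
    (hη : η = sInf {e : ℕ | ∃ b ∈ B, ∃ b' ∈ B,
        b ≠ b' ∧ (b - b').natAbs = e ∧ diamN X ≤ e})
    (u v : ℕ) (g : ℕ) (hg : 0 < g) :
    ((fun z : ℤ => (z : ZMod g)) '' (foldSum u B + foldSum v ↑X)).ncard ≤
      η * ((fun z : ℤ => (z : ZMod g)) '' (foldSum (u + v) B)).ncard := by
  haveI : NeZero g := ⟨hg.ne'⟩
  have hmem : η ∈ {e : ℕ | ∃ b ∈ B, ∃ b' ∈ B,
        b ≠ b' ∧ (b - b').natAbs = e ∧ diamN X ≤ e} := by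
    rw [hη]
    apply Nat.sInf_mem
    obtain ⟨b, hb, b', hb', h1, h2⟩ := exists_far B hBinf (diamN X)
    exact ⟨_, b, hb, b', hb', h1, rfl, h2⟩
  clear hη
  have hmem2 : ∃ b0 ∈ B, ∃ b1 ∈ B, b1 - b0 = (η : ℤ) ∧ 0 < η ∧ diamN X ≤ η := by
    obtain ⟨b, hb, b', hb', h1, h2, h3⟩ := hmem
    rcases le_total b b' with h | h
    · exact ⟨b, hb, b', hb', by omega, by omega, h3⟩
    · exact ⟨b', hb', b, hb, by omega, by omega, h3⟩
  obtain ⟨b0, hb0, b1, hb1, hd, hpos, hdiam⟩ := hmem2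
  set x0 := X.min' hXne with hx0
  have hX : ∀ x ∈ X, x0 ≤ x ∧ x ≤ x0 + η := by
    intro x hx
    have h1 : x0 ≤ x := X.min'_le x hx
    have h2 : (x - x0).natAbs ≤ diamN X :=
      Finset.le_sup (f := fun p : ℤ × ℤ => (p.1 - p.2).natAbs) (b := (x, x0))
        (Finset.mem_product.2 ⟨hx, X.min'_mem hXne⟩)
    omega
  set T := (fun z : ℤ => (z : ZMod g)) '' (foldSum (u + v) B) with hT
  have hsub : (fun z : ℤ => (z : ZMod g)) '' (foldSum u B + foldSum v ↑X) ⊆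
      (fun p : ℕ × ZMod g => (p.1 : ZMod g) + p.2 + ((v * x0 - v * b0 : ℤ) : ZMod g)) ''
        ((↑(Finset.range η) : Set ℕ) ×ˢ T) := by
    rintro _ ⟨_, ⟨s, hs, t, ⟨f, hf, rfl⟩, rfl⟩, rfl⟩
    have hlo : (v : ℤ) * x0 ≤ ∑ i, f i := by
      have := Finset.sum_le_sum (s := Finset.univ) (fun i _ => (hX (f i) (hf i)).1)
      simpa using this
    have hhi : ∑ i, f i ≤ (v : ℤ) * (x0 + η) := by
      have := Finset.sum_le_sum (s := Finset.univ) (fun i _ => (hX (f i) (hf i)).2)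
      simpa using this
    generalize ∑ i, f i = t at hlo hhi ⊢
    have hη' : (0 : ℤ) < η := by exact_mod_cast hpos
    obtain ⟨r, hr⟩ := Int.eq_ofNat_of_zero_le (Int.emod_nonneg (t - v * x0) hη'.ne')
    obtain ⟨k, hk⟩ := Int.eq_ofNat_of_zero_le
      (Int.ediv_nonneg (sub_nonneg.2 hlo) hη'.le)
    have hdm := Int.emod_add_mul_ediv (t - v * x0) η
    have hrlt := Int.emod_lt_of_pos (t - v * x0) hη'
    rw [hr] at hdm hrlt
    rw [hk] at hdm
    have hkv : k ≤ v := by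
      by_contra! hlt
      have : (v : ℤ) + 1 ≤ k := by exact_mod_cast hlt
      have h0 : (0 : ℤ) ≤ r := by positivity
      nlinarith
    obtain ⟨m, rfl⟩ := Nat.exists_eq_add_of_le hkv
    refine ⟨(r, ((s + ((k : ℤ) * b1 + (m : ℤ) * b0) : ℤ) : ZMod g)), ⟨?_, ?_⟩, ?_⟩
    · simpa using hrlt
    · exact ⟨_, foldSum_add_mem hs
        (foldSum_add_mem (foldSum_const_mem k hb1) (foldSum_const_mem m hb0)), rfl⟩
    · have : s + t = (r : ℤ) + (s + ((k : ℤ) * b1 + (m : ℤ) * b0))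
          + (((k + m : ℕ) : ℤ) * x0 - ((k + m : ℕ) : ℤ) * b0) := by
        push_cast at hdm ⊢
        rw [← hd] at hdm
        linear_combination -hdm
      simp only [this]
      push_cast
      ring
  calc _ ≤ _ := Set.ncard_le_ncard hsub (Set.toFinite _)
    _ ≤ _ := Set.ncard_image_le (Set.Finite.prod (Finset.finite_toSet _) (Set.toFinite _))
    _ = _ := by rw [Set.ncard_prod, Set.ncard_coe_finset, Finset.card_range]
end

section
/- Let G be a finite abelian group and B₁, …, B_n (n ≥ 1) nonempty subsets of G such that B₁ + ⋯ + B_n is not degenerate in G (i.e., stab_G(B₁ + ⋯ + B_n) = {0}). Then |B₁ + ⋯ + B_n| ≥ |B₁| + ⋯ + |B_n| − n + 1. -/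
open Pointwise

/-- The stabilizer of a subset `S` of an additive abelian group `G`:
`{t ∈ G | t + S = S}`. -/
def stabSet {G : Type*} [AddCommGroup G] (S : Set G) : Set G :=
  {t : G | t +ᵥ S = S}

/-- The sumset `B 0 + B 1 + ⋯ + B (n-1)` of a family of subsets of an
additive commutative monoid. -/
def famSum {G : Type*} [AddCommMonoid G] {n : ℕ} (B : Fin n → Set G) : Set G :=
  {x : G | ∃ f : Fin n → G, (∀ i, f i ∈ B i) ∧ ∑ i, f i = x}

open Classical in
/-- Counting lemma: `|Q| |P| ≤ |H₁ ∩ H₂| |Q + P|` for `Q ⊆ H₁`, `P ⊆ H₂`, phrased with a target. -/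
lemma kn_count {G : Type*} [AddCommGroup G] [Fintype G] (H₁ H₂ : AddSubgroup G) (c : G)
    (Q P D : Finset G) (hQ : ∀ x ∈ Q, x ∈ H₁) (hP : ∀ x ∈ P, x ∈ H₂)
    (hD : ∀ x ∈ Q, ∀ y ∈ P, c + x + y ∈ D) :
    Q.card * P.card ≤ (Finset.univ.filter (· ∈ H₁ ⊓ H₂)).card * D.card := by
  rw [← Finset.card_product]
  refine Finset.card_le_mul_card_image_of_maps_to (f := fun p : G × G => c + p.1 + p.2) ?_ _ ?_
  · rintro ⟨x, y⟩ h
    rw [Finset.mem_product] at h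
    exact hD _ h.1 _ h.2
  · intro d _
    by_cases hne : ((Q ×ˢ P).filter (fun p : G × G => c + p.1 + p.2 = d)).Nonempty
    · obtain ⟨⟨x₀, y₀⟩, h₀⟩ := hne
      simp only [Finset.mem_filter, Finset.mem_product] at h₀
      refine Finset.card_le_card_of_injOn (fun p : G × G => p.1 - x₀) ?_ ?_
      · rintro ⟨x, y⟩ h
        simp only [Finset.coe_filter, Finset.mem_product, Set.mem_ofPred_eq] at h
        simp only [Finset.coe_filter, Finset.mem_univ, true_and, Set.mem_ofPred_eq,
          AddSubgroup.mem_inf]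
        refine ⟨H₁.sub_mem (hQ _ h.1.1) (hQ _ h₀.1.1), ?_⟩
        have : x - x₀ = y₀ - y := by
          have := h.2.trans h₀.2.symm
          rw [sub_eq_sub_iff_add_eq_add]
          have h3 : c + (x + y) = c + (x₀ + y₀) := by simpa [add_assoc] using this
          rw [add_left_cancel h3, add_comm]
        rw [this]
        exact H₂.sub_mem (hP _ h₀.1.2) (hP _ h.1.2)
      · rintro ⟨x, y⟩ h ⟨x', y'⟩ h' hxx
        simp only [Finset.coe_filter, Finset.mem_product, Set.mem_ofPred_eq] at h h'
        have hx : x = x' := sub_left_injective hxx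
        subst hx
        have := h.2.trans h'.2.symm
        rw [add_left_cancel this]
    · rw [Finset.not_nonempty_iff_eq_empty.1 hne]; simp

lemma kn_arith (k a a' b b' d1 d2 h1 h2 : ℕ) (hk : 0 < k) (h1e : b + b' = h1) (h2e : a + a' = h2)
    (hb : k ≤ b) (ha' : k ≤ a') (ha : a = 0 ∨ k ≤ a) (hb' : b' = 0 ∨ k ≤ b')
    (hd1 : b * a' ≤ k * d1) (hd2 : b' * a ≤ k * d2) :
    h1 ≤ d1 + k ∨ h2 ≤ d2 + k ∨ h2 ≤ d1 := by
  subst h1e h2e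
  rcases hb' with rfl | hb'
  · left
    have : k * b ≤ k * d1 := by nlinarith
    have := Nat.le_of_mul_le_mul_left this hk
    omega
  rcases ha with rfl | ha
  · right; right
    have : k * a' ≤ k * d1 := by nlinarith
    have := Nat.le_of_mul_le_mul_left this hk
    omega
  obtain ⟨a, rfl⟩ := Nat.exists_eq_add_of_le ha
  obtain ⟨b, rfl⟩ := Nat.exists_eq_add_of_le hb
  rcases le_total b' a' with h | h
  · left
    obtain ⟨b', rfl⟩ := Nat.exists_eq_add_of_le hb'
    refine Nat.le_of_mul_le_mul_left ?_ hk
    have : (k + b) * (k + b') ≤ (k + b) * a' := Nat.mul_le_mul_left _ h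
    nlinarith [Nat.zero_le (b * b')]
  · right; left
    obtain ⟨a', rfl⟩ := Nat.exists_eq_add_of_le ha'
    refine Nat.le_of_mul_le_mul_left ?_ hk
    have : (k + a') * (k + a) ≤ b' * (k + a) := Nat.mul_le_mul_right _ h
    nlinarith [Nat.zero_le (a * a')]

open Classical in
/-- The number of elements of a subgroup. -/
noncomputable def knCard {G : Type*} [AddCommGroup G] [Fintype G] (H : AddSubgroup G) : ℕ :=
  (Finset.univ.filter (· ∈ H)).card

open Classical in
lemma kn_coset {G : Type*} [AddCommGroup G] [Fintype G] (K : AddSubgroup G) (P : Finset G)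
    (h : ∀ k ∈ K, ∀ x ∈ P, k + x ∈ P) : P.card = 0 ∨ knCard K ≤ P.card := by
  rcases P.eq_empty_or_nonempty with rfl | ⟨x, hx⟩
  · simp
  · right
    refine Finset.card_le_card_of_injOn (fun k => k + x) ?_ ?_
    · intro k hk
      exact h k (by simpa using hk) x hx
    · intro k _ k' _ hkk
      exact add_left_injective x hkk

open Classical in
lemma kn_inv_iff {G : Type*} [AddCommGroup G] {H : AddSubgroup G} {C : Finset G}
    (h : ∀ k ∈ H, ∀ x ∈ C, k + x ∈ C) {k : G} (hk : k ∈ H) (x : G) : k + x ∈ C ↔ x ∈ C := by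
  refine ⟨fun hx => ?_, h k hk x⟩
  simpa using h (-k) (H.neg_mem hk) _ hx

open Classical in
lemma kn_sub {G : Type*} [AddCommGroup G] [Fintype G] (H₁ H₂ : AddSubgroup G)
    (C₁ C₂ : Finset G) (hC₁ : ∀ k ∈ H₁, ∀ x ∈ C₁, k + x ∈ C₁)
    (hC₂ : ∀ k ∈ H₂, ∀ x ∈ C₂, k + x ∈ C₂) (hn : ¬ C₂ ⊆ C₁) :
    knCard H₁ ≤ (C₂ \ C₁).card + knCard (H₁ ⊓ H₂) ∨
    knCard H₂ ≤ (C₁ \ C₂).card + knCard (H₁ ⊓ H₂) ∨ knCard H₂ ≤ (C₂ \ C₁).card := by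
  obtain ⟨c, hc2, hc1⟩ := Finset.not_subset.1 hn
  set S₁ : Finset G := Finset.univ.filter (· ∈ H₁) with hS₁
  set S₂ : Finset G := Finset.univ.filter (· ∈ H₂) with hS₂
  have e₁ : ∀ x y, x ∈ H₁ → (c + x + y ∈ C₁ ↔ c + y ∈ C₁) := by
    intro x y hx
    rw [← kn_inv_iff hC₁ hx (c + y), show c + x + y = x + (c + y) by abel]
  have e₂ : ∀ x y, y ∈ H₂ → (c + x + y ∈ C₂ ↔ c + x ∈ C₂) := by
    intro x y hy
    rw [← kn_inv_iff hC₂ hy (c + x), show c + x + y = y + (c + x) by abel]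
  have i₁ : ∀ k ∈ H₁ ⊓ H₂, ∀ x, (c + (k + x) ∈ C₁ ↔ c + x ∈ C₁) := by
    intro k hk x
    rw [← e₁ k x hk.1, add_assoc]
  have i₂ : ∀ k ∈ H₁ ⊓ H₂, ∀ x, (c + (k + x) ∈ C₂ ↔ c + x ∈ C₂) := by
    intro k hk x
    rw [← e₂ x k hk.2, show c + (k + x) = c + x + k by abel]
  refine kn_arith (knCard (H₁ ⊓ H₂)) (S₂.filter (fun y => c + y ∈ C₁)).card
    (S₂.filter (fun y => ¬ c + y ∈ C₁)).card (S₁.filter (fun y => c + y ∈ C₂)).card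
    (S₁.filter (fun y => ¬ c + y ∈ C₂)).card _ _ _ _ ?_ ?_ ?_ ?_ ?_ ?_ ?_ ?_ ?_
  · exact Finset.card_pos.2 ⟨0, by simp [AddSubgroup.zero_mem]⟩
  · exact Finset.card_filter_add_card_filter_not _
  · exact Finset.card_filter_add_card_filter_not _
  · refine (kn_coset (H₁ ⊓ H₂) _ ?_).resolve_left ?_
    · intro k hk x hx
      simp only [hS₁, Finset.mem_filter, Finset.mem_univ, true_and] at hx ⊢
      exact ⟨H₁.add_mem hk.1 hx.1, (i₂ k hk x).2 hx.2⟩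
    · exact (Finset.card_pos.2 ⟨0, by simp [hS₁, H₁.zero_mem, hc2]⟩).ne'
  · refine (kn_coset (H₁ ⊓ H₂) _ ?_).resolve_left ?_
    · intro k hk x hx
      simp only [hS₂, Finset.mem_filter, Finset.mem_univ, true_and] at hx ⊢
      exact ⟨H₂.add_mem hk.2 hx.1, fun h => hx.2 ((i₁ k hk x).1 h)⟩
    · exact (Finset.card_pos.2 ⟨0, by simp [hS₂, H₂.zero_mem, hc1]⟩).ne'
  · refine kn_coset (H₁ ⊓ H₂) _ ?_
    intro k hk x hx
    simp only [hS₂, Finset.mem_filter, Finset.mem_univ, true_and] at hx ⊢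
    exact ⟨H₂.add_mem hk.2 hx.1, (i₁ k hk x).2 hx.2⟩
  · refine kn_coset (H₁ ⊓ H₂) _ ?_
    intro k hk x hx
    simp only [hS₁, Finset.mem_filter, Finset.mem_univ, true_and] at hx ⊢
    exact ⟨H₁.add_mem hk.1 hx.1, fun h => hx.2 ((i₂ k hk x).1 h)⟩
  · refine kn_count H₁ H₂ c _ _ _ ?_ ?_ ?_
    · intro x hx
      simp only [hS₁, Finset.mem_filter, Finset.mem_univ, true_and] at hx
      exact hx.1
    · intro x hx
      simp only [hS₂, Finset.mem_filter, Finset.mem_univ, true_and] at hx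
      exact hx.1
    · intro x hx y hy
      simp only [hS₁, hS₂, Finset.mem_filter, Finset.mem_univ, true_and] at hx hy
      rw [Finset.mem_sdiff, e₁ x y hx.1, e₂ x y hy.1]
      exact ⟨hx.2, hy.2⟩
  · refine kn_count H₁ H₂ c _ _ _ ?_ ?_ ?_
    · intro x hx
      simp only [hS₁, Finset.mem_filter, Finset.mem_univ, true_and] at hx
      exact hx.1
    · intro x hx
      simp only [hS₂, Finset.mem_filter, Finset.mem_univ, true_and] at hx
      exact hx.1
    · intro x hx y hy
      simp only [hS₁, hS₂, Finset.mem_filter, Finset.mem_univ, true_and] at hx hy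
      rw [Finset.mem_sdiff, e₁ x y hx.1, e₂ x y hy.1]
      exact ⟨hy.2, hx.2⟩

/-- `C` is invariant under a subgroup `H` with `N ≤ |C| + |H|`. -/
def KnGood {G : Type*} [AddCommGroup G] [Fintype G] (N : ℕ) (C : Finset G) : Prop :=
  ∃ H : AddSubgroup G, (∀ k ∈ H, ∀ x ∈ C, k + x ∈ C) ∧ N ≤ C.card + knCard H

open Classical in
lemma KnGood.union {G : Type*} [AddCommGroup G] [Fintype G] {N : ℕ} {C₁ C₂ : Finset G}
    (g₁ : KnGood N C₁) (g₂ : KnGood N C₂) : KnGood N (C₁ ∪ C₂) := by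
  by_cases h12 : C₁ ⊆ C₂
  · rwa [Finset.union_eq_right.2 h12]
  by_cases h21 : C₂ ⊆ C₁
  · rwa [Finset.union_eq_left.2 h21]
  obtain ⟨H₁, i₁, n₁⟩ := g₁
  obtain ⟨H₂, i₂, n₂⟩ := g₂
  refine ⟨H₁ ⊓ H₂, ?_, ?_⟩
  · intro k hk x hx
    rcases Finset.mem_union.1 hx with hx | hx
    · exact Finset.mem_union_left _ (i₁ k hk.1 x hx)
    · exact Finset.mem_union_right _ (i₂ k hk.2 x hx)
  · have s₁ := kn_sub H₁ H₂ C₁ C₂ i₁ i₂ h21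
    have s₂ := kn_sub H₂ H₁ C₂ C₁ i₂ i₁ h12
    rw [inf_comm H₂ H₁] at s₂
    have c₁ : (C₁ ∪ C₂).card = C₁.card + (C₂ \ C₁).card := by
      rw [← Finset.card_union_of_disjoint Finset.disjoint_sdiff, Finset.union_sdiff_self_eq_union]
    have c₂ : (C₁ ∪ C₂).card = C₂.card + (C₁ \ C₂).card := by
      rw [← Finset.card_union_of_disjoint Finset.disjoint_sdiff, Finset.union_sdiff_self_eq_union,
        Finset.union_comm]
    omega

open Classical in
lemma kn_exists {G : Type*} [AddCommGroup G] [Fintype G] (a b : G) :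
    ∀ (n : ℕ) (A B : Finset G), B.card = n → a ∈ A → b ∈ B →
      ∃ C : Finset G, C ⊆ A + B ∧ a + b ∈ C ∧ KnGood (A.card + B.card) C := by
  intro n
  induction n using Nat.strong_induction_on with
  | _ n ih =>
  intro A B hn ha hb
  by_cases hall : ∀ a' ∈ A, ∀ y ∈ B, a' - b + y ∈ A
  · refine ⟨b +ᵥ A, ?_, ?_, AddAction.stabilizer G A, ?_, ?_⟩
    · intro x hx
      obtain ⟨y, hy, rfl⟩ := Finset.mem_vadd_finset.1 hx
      rw [vadd_eq_add, add_comm b y]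
      exact Finset.add_mem_add hy hb
    · rw [add_comm a b]
      exact Finset.vadd_mem_vadd_finset ha
    · intro k hk x hx
      obtain ⟨y, hy, rfl⟩ := Finset.mem_vadd_finset.1 hx
      have hk' : k +ᵥ A = A := hk
      have : k + y ∈ A := by
        rw [← hk']
        exact Finset.vadd_mem_vadd_finset hy
      rw [vadd_eq_add, show k + (b + y) = b + (k + y) by abel]
      exact Finset.vadd_mem_vadd_finset this
    · rw [Finset.card_vadd_finset]
      refine Nat.add_le_add_left ?_ _
      refine Finset.card_le_card_of_injOn (fun y => y - b) ?_ ?_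
      · intro y hy
        simp only [Finset.coe_filter, Finset.mem_univ, true_and, Set.mem_ofPred_eq]
        change (y - b) +ᵥ A = A
        refine Finset.eq_of_subset_of_card_le ?_ ?_
        · intro x hx
          obtain ⟨z, hz, rfl⟩ := Finset.mem_vadd_finset.1 hx
          rw [vadd_eq_add, show y - b + z = z - b + y by abel]
          exact hall z hz y hy
        · rw [Finset.card_vadd_finset]
      · intro y _ y' _ h
        exact sub_left_injective h
  · push Not at hall
    obtain ⟨a', ha', y, hy, hya⟩ := hall
    set e := a' - b with he
    have hsub := Finset.addDysonETransform.subset e (A, B)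
    have hcard := Finset.addDysonETransform.card e (A, B)
    simp only [Finset.addDysonETransform] at hsub hcard
    have hlt : (B ∩ (-e +ᵥ A)).card < n := by
      rw [← hn]
      refine Finset.card_lt_card ⟨Finset.inter_subset_left, fun h => ?_⟩
      have := (Finset.mem_inter.1 (h hy)).2
      obtain ⟨z, hz, hz'⟩ := Finset.mem_vadd_finset.1 this
      apply hya
      rw [← hz', vadd_eq_add, add_neg_cancel_left]
      exact hz
    obtain ⟨C, hC, hab, hg⟩ := ih _ hlt (A ∪ (e +ᵥ B)) (B ∩ (-e +ᵥ A)) rfl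
      (Finset.mem_union_left _ ha)
      (Finset.mem_inter.2 ⟨hb, Finset.mem_vadd_finset.2 ⟨a', ha', by rw [he, vadd_eq_add]; abel⟩⟩)
    refine ⟨C, hC.trans hsub, hab, ?_⟩
    rwa [hcard] at hg

open Classical in
/-- Kneser's theorem (weak form). -/
lemma kn_kneser {G : Type*} [AddCommGroup G] [Fintype G] (A B : Finset G)
    (hA : A.Nonempty) (hB : B.Nonempty) : KnGood (A.card + B.card) (A + B) := by
  have key : ∀ p : G × G, ∃ C : Finset G, p ∈ A ×ˢ B →
      C ⊆ A + B ∧ p.1 + p.2 ∈ C ∧ KnGood (A.card + B.card) C := by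
    intro p
    by_cases hp : p ∈ A ×ˢ B
    · obtain ⟨C, hC⟩ := kn_exists p.1 p.2 _ A B rfl (Finset.mem_product.1 hp).1
        (Finset.mem_product.1 hp).2
      exact ⟨C, fun _ => hC⟩
    · exact ⟨∅, fun h => absurd h hp⟩
  choose f hf using key
  have hU : A + B = (A ×ˢ B).sup' (hA.product hB) f := by
    apply le_antisymm
    · intro x hx
      obtain ⟨a, ha, b, hb, rfl⟩ := Finset.mem_add.1 hx
      have hp : (a, b) ∈ A ×ˢ B := Finset.mem_product.2 ⟨ha, hb⟩
      exact Finset.le_sup' f hp (hf _ hp).2.1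
    · exact Finset.sup'_le _ _ fun p hp => (hf p hp).1
  rw [hU]
  exact Finset.sup'_induction _ _ (fun _ h₁ _ h₂ => h₁.union h₂) fun p hp => (hf p hp).2.2

lemma kn_two {G : Type*} [AddCommGroup G] [Fintype G] (A B : Set G)
    (hA : A.Nonempty) (hB : B.Nonempty) (hs : ∀ t : G, t +ᵥ (A + B) = A + B → t = 0) :
    A.ncard + B.ncard ≤ (A + B).ncard + 1 := by
  classical
  obtain ⟨H, hH, hc⟩ := kn_kneser A.toFinset B.toFinset (by simpa using hA) (by simpa using hB)
  have hAB : A.toFinset + B.toFinset = (A + B).toFinset := by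
    ext x; simp [Finset.mem_add, Set.mem_add]
  rw [hAB] at hH hc
  simp only [Set.ncard_eq_toFinset_card']
  refine hc.trans (Nat.add_le_add_left ?_ _)
  refine Finset.card_le_one_iff_subset_singleton.2 ⟨0, ?_⟩
  intro k hk
  rw [Finset.mem_filter] at hk
  rw [Finset.mem_singleton]
  apply hs
  ext x
  rw [Set.mem_vadd_set_iff_neg_vadd_mem, vadd_eq_add]
  have := kn_inv_iff hH (H.neg_mem hk.2) x
  rwa [Set.mem_toFinset, Set.mem_toFinset] at this

lemma kn_main {G : Type*} [AddCommGroup G] [Fintype G] (n : ℕ) :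
    ∀ (B : Fin n → Set G), (∀ i, (B i).Nonempty) →
    (∀ t : G, t +ᵥ famSum B = famSum B → t = 0) →
    (∑ i, ((B i).ncard : ℤ)) - n + 1 ≤ ((famSum B).ncard : ℤ) := by
  induction n with
  | zero =>
    intro B _ _
    have : famSum B = {0} := by
      ext x; simp [famSum, eq_comm]
    simp [this]
  | succ n ih =>
    intro B hB hs
    have hsum : famSum B = B 0 + famSum (fun i : Fin n => B i.succ) := by
      ext x
      rw [Set.mem_add]
      constructor
      · rintro ⟨f, hf, rfl⟩
        exact ⟨f 0, hf 0, _, ⟨fun i => f i.succ, fun i => hf _, rfl⟩, (Fin.sum_univ_succ f).symm⟩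
      · rintro ⟨a, ha, _, ⟨g, hg, rfl⟩, rfl⟩
        refine ⟨Fin.cons a g, ?_, ?_⟩
        · intro i
          refine Fin.cases ?_ ?_ i
          · simpa using ha
          · intro j; simpa using hg j
        · simp [Fin.sum_univ_succ]
    have hne : (famSum (fun i : Fin n => B i.succ)).Nonempty := by
      choose f hf using hB
      exact ⟨_, fun i => f i.succ, fun i => hf _, rfl⟩
    rw [hsum] at hs ⊢
    have h1 := ih (fun i => B i.succ) (fun i => hB _) (by
      intro t ht
      apply hs
      rw [← add_vadd_comm, ht])
    have h2 := kn_two (B 0) _ (hB 0) hne hs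
    rw [Fin.sum_univ_succ]
    push_cast
    zify at h2
    linarith

theorem kneser_corollary_card_sum_ge
    {G : Type*} [AddCommGroup G] [Fintype G] (n : ℕ) (hn : 1 ≤ n)
    (B : Fin n → Set G) (hB : ∀ i, (B i).Nonempty)
    (hstab : stabSet (famSum B) = {0}) :
    (∑ i, ((B i).ncard : ℤ)) - n + 1 ≤ ((famSum B).ncard : ℤ) := by
  refine kn_main n B hB fun t ht => ?_
  have : t ∈ stabSet (famSum B) := ht
  rwa [hstab] at this
end
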